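/- For all integers m ≥ 4 and n ≥ 2 there exist: homogeneous polynomials f ∈ ℂ[z₀,z₁,z₂] of degree m and g ∈ ℂ[z₀,z₃,z₄] of degree n with f(1,0,0) ≠ 0 and g(1,0,0) ≠ 0; a nonzero homogeneous polynomial r ∈ ℂ[z₁,z₂,z₃,z₄] of degree mn satisfying r(z₁,z₂,z₃,z₄) = 0 ⟺ ∃ z₀ ∈ ℂ, f(z₀,z₁,z₂) = 0 ∧ g(z₀,z₃,z₄) = 0, for all (z₁,z₂,z₃,z₄) ∈ ℂ⁴; a homogeneous polynomial f_∞ ∈ ℂ[z₁,z₂,z₃,z₄] of degree mn; and ε > 0; such that for every t ∈ ℂ with 0 < |t| < ε, every holomorphic map h : ℂ → ℂ⁴ with h(w) ≠ 0 for all w and r(h(w)) + t·f_∞(h(w)) = 0 for all w ∈ ℂ has pairwise linearly dependent values, i.e. h(w) and h(w′) are linearly dependent over ℂ for all w, w′ ∈ ℂ. -/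

import Mathlib

open MvPolynomial
open Filter Topology

namespace EntireCurve

variable {ι : Type*}

/-- The affine chart of `p` in which the `j`-th homogeneous coordinate equals `1`. -/
noncomputable def chart (p : ℂ → ι → ℂ) (j : ι) (w : ℂ) : ι → ℂ := (p w j)⁻¹ • p w

/-- `p w` are homogeneous coordinates, with an arbitrary scalar factor at each point,
of a holomorphic curve in projective space. -/
def IsProjCurve [Fintype ι] (p : ℂ → ι → ℂ) : Prop :=
  ∀ w, p w ≠ 0 ∧ ∀ j, p w j ≠ 0 → AnalyticAt ℂ (chart p j) w

/-- The projective curve represented by `p` is constant. -/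
def IsProjConst (p : ℂ → ι → ℂ) : Prop := ∀ w w', ∃ c : ℂ, p w' = c • p w

theorem chart_apply_self {p : ℂ → ι → ℂ} {j : ι} {w : ℂ} (h : p w j ≠ 0) :
    chart p j w j = 1 := by simp [chart, h]

theorem eq_smul_chart {p : ℂ → ι → ℂ} {j : ι} {w : ℂ} (h : p w j ≠ 0) :
    p w = p w j • chart p j w := by simp [chart, smul_smul, h]

theorem chart_eq_inv_smul_chart {p : ℂ → ι → ℂ} {j : ι} {w : ℂ} (h : p w j ≠ 0) (k : ι) :
    chart p k w = (chart p j w k)⁻¹ • chart p j w := by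
  simp only [chart, Pi.smul_apply, smul_eq_mul, smul_smul, mul_inv, inv_inv]
  congr 1
  field_simp

theorem chart_ne_zero {p : ℂ → ι → ℂ} {j : ι} {w : ℂ} (h : p w j ≠ 0) : chart p j w ≠ 0 :=
  fun h0 => by simpa [h0] using chart_apply_self h

theorem chart_smul {p : ℂ → ι → ℂ} {q : ℂ → ι → ℂ} {w c : ℂ} (hc : c ≠ 0) (h : p w = c • q w)
    (j : ι) : chart p j w = chart q j w := by
  simp only [chart, h, Pi.smul_apply, smul_eq_mul, smul_smul, mul_inv]
  congr 1
  field_simp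

theorem chart_apply_ne_zero {p : ℂ → ι → ℂ} {j k : ι} {w : ℂ} (hj : p w j ≠ 0)
    (hk : p w k ≠ 0) : chart p j w k ≠ 0 := by simp [chart, hj, hk]

variable [Fintype ι]

theorem analyticAt_apply_coord {H : ℂ → ι → ℂ} {w : ℂ} (hH : AnalyticAt ℂ H w) (j : ι) :
    AnalyticAt ℂ (fun z => H z j) w :=
  ((ContinuousLinearMap.proj (R := ℂ) (φ := fun _ : ι => ℂ) j).analyticAt _).comp hH

theorem IsProjCurve.exists_ne_zero {p : ℂ → ι → ℂ} (hp : IsProjCurve p) (w : ℂ) :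
    ∃ j, p w j ≠ 0 := Function.ne_iff.1 (hp w).1

theorem IsProjCurve.eventually_ne_zero {p : ℂ → ι → ℂ} (hp : IsProjCurve p) {w : ℂ} {j : ι}
    (h : p w j ≠ 0) : ∀ᶠ z in 𝓝 w, p z j ≠ 0 := by
  have h1 : ContinuousAt (fun z => chart p j z j) w :=
    (continuous_apply j).continuousAt.comp ((hp w).2 j h).continuousAt
  have h2 : ∀ᶠ z in 𝓝 w, chart p j z j ≠ 0 :=
    h1.eventually_ne (by simp [chart_apply_self h])
  filter_upwards [h2] with z hz h0
  simp [chart, h0] at hz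

theorem isProjCurve_of_lift {p : ℂ → ι → ℂ}
    (h : ∀ w, ∃ H : ℂ → ι → ℂ, AnalyticAt ℂ H w ∧ H w ≠ 0 ∧
      ∀ᶠ z in 𝓝 w, ∃ c : ℂ, c ≠ 0 ∧ p z = c • H z) : IsProjCurve p := by
  intro w
  obtain ⟨H, hH, hw, hev⟩ := h w
  obtain ⟨c, hc, hpc⟩ := hev.self_of_nhds
  refine ⟨by rw [hpc]; exact smul_ne_zero hc hw, fun j hj => ?_⟩
  have hHj : H w j ≠ 0 := fun h0 => hj (by simp [hpc, h0])
  have : AnalyticAt ℂ (chart H j) w := ((analyticAt_apply_coord hH j).inv hHj).smul hH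
  refine this.congr ?_
  filter_upwards [hev] with z ⟨c, hc, hz⟩
  exact (chart_smul hc hz j).symm

theorem isProjCurve_of_differentiable {h : ℂ → ι → ℂ} (hd : Differentiable ℂ h)
    (h0 : ∀ w, h w ≠ 0) : IsProjCurve h :=
  isProjCurve_of_lift fun w =>
    ⟨h, hd.analyticAt w, h0 w, Eventually.of_forall fun _ => ⟨1, one_ne_zero, by simp⟩⟩

theorem IsProjCurve.eventually_chart_eq {p : ℂ → ι → ℂ} (hp : IsProjCurve p) {w : ℂ} {j : ι}
    (hj : p w j ≠ 0) (k : ι) :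
    chart p k =ᶠ[𝓝 w] fun z => (chart p j z k)⁻¹ • chart p j z :=
  (hp.eventually_ne_zero hj).mono fun _ hz => chart_eq_inv_smul_chart hz k

theorem IsProjCurve.deriv_chart {p : ℂ → ι → ℂ} (hp : IsProjCurve p) {w : ℂ} {j k : ι}
    (hj : p w j ≠ 0) (hk : p w k ≠ 0) :
    deriv (chart p k) w = (chart p j w k)⁻¹ • deriv (chart p j) w +
      (-deriv (chart p j) w k / chart p j w k ^ 2) • chart p j w := by
  have ha := ((hp w).2 j hj).differentiableAt
  have hak : HasDerivAt (fun z => chart p j z k) (deriv (chart p j) w k) w :=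
    hasDerivAt_pi.1 ha.hasDerivAt k
  rw [(hp.eventually_chart_eq hj k).deriv_eq]
  exact ((hak.fun_inv (chart_apply_ne_zero hj hk)).fun_smul ha.hasDerivAt).deriv

theorem IsProjCurve.norm_deriv_chart_le {p : ℂ → ι → ℂ} (hp : IsProjCurve p) {w : ℂ} {j k : ι}
    (hj : p w j ≠ 0) (hk : p w k ≠ 0) :
    ‖deriv (chart p k) w‖ ≤
      2 * ‖deriv (chart p j) w‖ * ‖chart p j w‖ / ‖chart p j w k‖ ^ 2 := by
  have hne : 0 < ‖chart p j w k‖ := norm_pos_iff.2 (chart_apply_ne_zero hj hk)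
  rw [hp.deriv_chart hj hk]
  have h1 : ‖deriv (chart p j) w k‖ ≤ ‖deriv (chart p j) w‖ := norm_le_pi_norm _ k
  have h2 : ‖chart p j w k‖ ≤ ‖chart p j w‖ := norm_le_pi_norm _ k
  calc _ ≤ ‖(chart p j w k)⁻¹ • deriv (chart p j) w‖ +
        ‖(-deriv (chart p j) w k / chart p j w k ^ 2) • chart p j w‖ := norm_add_le _ _
    _ = ‖deriv (chart p j) w‖ * ‖chart p j w k‖ / ‖chart p j w k‖ ^ 2 +
        ‖deriv (chart p j) w k‖ * ‖chart p j w‖ / ‖chart p j w k‖ ^ 2 := by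
        simp only [norm_smul, norm_inv, norm_div, norm_neg, norm_pow]
        field_simp
    _ ≤ ‖deriv (chart p j) w‖ * ‖chart p j w‖ / ‖chart p j w k‖ ^ 2 +
        ‖deriv (chart p j) w‖ * ‖chart p j w‖ / ‖chart p j w k‖ ^ 2 := by gcongr
    _ = _ := by ring

theorem norm_chart {p : ℂ → ι → ℂ} (j : ι) (w : ℂ) : ‖chart p j w‖ = ‖p w‖ / ‖p w j‖ := by
  rw [chart, norm_smul, norm_inv]; ring

theorem IsProjCurve.comp_affine {p : ℂ → ι → ℂ} (hp : IsProjCurve p) (a b : ℂ) :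
    IsProjCurve fun z => p (a + b * z) := by
  intro w
  refine ⟨(hp _).1, fun j hj => ?_⟩
  have h1 : AnalyticAt ℂ (fun z : ℂ => a + b * z) w := by fun_prop
  exact AnalyticAt.comp (f := fun z : ℂ => a + b * z) ((hp (a + b * w)).2 j hj) h1

section Speed

variable [Nonempty ι]

theorem exists_topCoord (v : ι → ℂ) : ∃ i, ∀ j, ‖v j‖ ≤ ‖v i‖ :=
  Finite.exists_max fun i => ‖v i‖

/-- A coordinate of maximal modulus. -/
noncomputable def topCoord (v : ι → ℂ) : ι := (exists_topCoord v).choose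

theorem norm_topCoord (v : ι → ℂ) : ‖v (topCoord v)‖ = ‖v‖ :=
  le_antisymm (norm_le_pi_norm v _)
    ((pi_norm_le_iff_of_nonneg (norm_nonneg _)).2 (exists_topCoord v).choose_spec)

/-- The norm of the derivative of the curve in a chart normalised at the given point. -/
noncomputable def speed (p : ℂ → ι → ℂ) (w : ℂ) : ℝ := ‖deriv (chart p (topCoord (p w))) w‖

theorem IsProjCurve.apply_topCoord_ne_zero {p : ℂ → ι → ℂ} (hp : IsProjCurve p) (w : ℂ) :
    p w (topCoord (p w)) ≠ 0 := by
  rw [← norm_pos_iff, norm_topCoord]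
  exact norm_pos_iff.2 (hp w).1

theorem IsProjCurve.norm_chart_topCoord {p : ℂ → ι → ℂ} (hp : IsProjCurve p) (w : ℂ) :
    ‖chart p (topCoord (p w)) w‖ = 1 := by
  rw [norm_chart, norm_topCoord, div_self (norm_ne_zero_iff.2 (hp w).1)]

theorem IsProjCurve.norm_deriv_chart_le_speed {p : ℂ → ι → ℂ} (hp : IsProjCurve p) {w : ℂ}
    {k : ι} (hk : p w k ≠ 0) :
    ‖deriv (chart p k) w‖ ≤ 2 * speed p w * ‖chart p k w‖ ^ 2 := by
  have h := hp.norm_deriv_chart_le (hp.apply_topCoord_ne_zero w) hk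
  rw [hp.norm_chart_topCoord] at h
  refine h.trans_eq ?_
  have h1 : ‖chart p (topCoord (p w)) w k‖ = ‖p w k‖ / ‖p w‖ := by
    simp only [chart, Pi.smul_apply, smul_eq_mul, norm_mul, norm_inv, norm_topCoord]; ring
  rw [h1, norm_chart, speed]
  have := norm_pos_iff.2 (hp w).1
  have := norm_pos_iff.2 hk
  field_simp

theorem IsProjCurve.speed_le {p : ℂ → ι → ℂ} (hp : IsProjCurve p) {w : ℂ}
    {j : ι} (hj : p w j ≠ 0) : speed p w ≤ 2 * ‖deriv (chart p j) w‖ := by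
  have h := hp.norm_deriv_chart_le hj (hp.apply_topCoord_ne_zero w)
  have h1 : ‖chart p j w (topCoord (p w))‖ = ‖chart p j w‖ := by
    simp only [chart, Pi.smul_apply, smul_eq_mul, norm_mul, norm_smul, norm_inv, norm_topCoord]
  have h2 : 1 ≤ ‖chart p j w‖ := by
    simpa [chart_apply_self hj] using norm_le_pi_norm (chart p j w) j
  rw [h1] at h
  refine h.trans ?_
  rw [div_le_iff₀ (by positivity)]
  have := norm_nonneg (deriv (chart p j) w)
  nlinarith [mul_nonneg this (sub_nonneg.2 h2),
    mul_nonneg (mul_nonneg this (sub_nonneg.2 h2)) (norm_nonneg (chart p j w))]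

theorem speed_nonneg (p : ℂ → ι → ℂ) (w : ℂ) : 0 ≤ speed p w := norm_nonneg _

theorem speed_comp_affine (p : ℂ → ι → ℂ) (a b w : ℂ) :
    speed (fun z => p (a + b * z)) w = ‖b‖ * speed p (a + b * w) := by
  set j := topCoord (p (a + b * w)) with hj
  have : chart (fun z => p (a + b * z)) j = fun z => (fun u => chart p j (a + u)) (b * z) := rfl
  rw [speed, speed, ← hj, this, deriv_comp_mul_left b (fun u => chart p j (a + u)),
    deriv_comp_const_add, norm_smul]

/-- The speed is bounded on bounded sets. -/
theorem IsProjCurve.exists_speed_le {p : ℂ → ι → ℂ} (hp : IsProjCurve p) (R : ℝ) :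
    ∃ M, ∀ w ∈ Metric.closedBall (0 : ℂ) R, speed p w ≤ M := by
  refine (isCompact_closedBall (0 : ℂ) R).induction_on (p := fun s => ∃ M, ∀ w ∈ s, speed p w ≤ M)
    ⟨0, by simp⟩ (fun s t hst ⟨M, hM⟩ => ⟨M, fun w hw => hM w (hst hw)⟩)
    (fun s t ⟨M, hM⟩ ⟨N, hN⟩ => ⟨max M N, fun w hw => hw.elim
      (fun h => (hM w h).trans (le_max_left _ _)) fun h => (hN w h).trans (le_max_right _ _)⟩) ?_
  intro w _
  obtain ⟨j, hj⟩ := hp.exists_ne_zero w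
  have hc : ContinuousAt (fun z => ‖deriv (chart p j) z‖) w :=
    (((hp w).2 j hj).deriv.continuousAt).norm
  have h1 := hc.eventually_lt (continuousAt_const (y := ‖deriv (chart p j) w‖ + 1)) (by simp)
  refine ⟨_, mem_nhdsWithin_of_mem_nhds (h1.and (hp.eventually_ne_zero hj)),
    2 * (‖deriv (chart p j) w‖ + 1), fun z hz => ?_⟩
  exact (hp.speed_le hz.2).trans (by linarith [hz.1])

/-- A curve of zero speed is constant. -/
theorem IsProjCurve.isProjConst_of_speed_eq_zero {p : ℂ → ι → ℂ} (hp : IsProjCurve p)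
    (h : ∀ w, speed p w = 0) : IsProjConst p := by
  have hloc : ∀ w, ∀ᶠ z in 𝓝 w, ∃ c : ℂ, c ≠ 0 ∧ p z = c • p w := by
    intro w
    obtain ⟨j, hj⟩ := hp.exists_ne_zero w
    obtain ⟨r, hr, hball⟩ := Metric.eventually_nhds_iff_ball.1 (hp.eventually_ne_zero hj)
    filter_upwards [Metric.ball_mem_nhds w hr] with z hz
    have hd : ∀ u ∈ Metric.ball w r, DifferentiableAt ℂ (chart p j) u :=
      fun u hu => ((hp u).2 j (hball u hu)).differentiableAt
    have hd0 : ∀ u ∈ Metric.ball w r, ‖deriv (chart p j) u‖ ≤ 0 := fun u hu => by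
      simpa [h u] using hp.norm_deriv_chart_le_speed (hball u hu)
    have := (convex_ball w r).norm_image_sub_le_of_norm_deriv_le hd hd0
      (Metric.mem_ball_self hr) hz
    rw [zero_mul, norm_le_zero_iff, sub_eq_zero] at this
    refine ⟨p z j * (p w j)⁻¹, mul_ne_zero (hball z hz) (inv_ne_zero hj), ?_⟩
    rw [mul_smul, ← chart, ← this]
    exact eq_smul_chart (hball z hz)
  intro w w'
  have hcl : IsClopen {z | ∃ c : ℂ, c ≠ 0 ∧ p z = c • p w} := by
    refine ⟨⟨isOpen_iff_mem_nhds.2 fun z hz => ?_⟩, isOpen_iff_mem_nhds.2 fun z hz => ?_⟩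
    · filter_upwards [hloc z] with u ⟨d, hd, hu⟩ ⟨c, hc, hu'⟩
      refine hz ⟨d⁻¹ * c, mul_ne_zero (inv_ne_zero hd) hc, ?_⟩
      rw [← smul_smul, ← hu', hu, smul_smul, inv_mul_cancel₀ hd, one_smul]
    · obtain ⟨c, hc, hz⟩ := hz
      filter_upwards [hloc z] with u ⟨d, hd, hu⟩
      exact ⟨d * c, mul_ne_zero hd hc, by rw [hu, hz, smul_smul]⟩
  have := hcl.eq_univ ⟨w, 1, one_ne_zero, by simp⟩
  obtain ⟨c, -, hc⟩ := (Set.eq_univ_iff_forall.1 this) w'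
  exact ⟨c, hc⟩

end Speed

end EntireCurve

namespace EntireCurve

variable {ι : Type*} [Fintype ι]

theorem IsProjCurve.isClosed_norm_le {p : ℂ → ι → ℂ} (hp : IsProjCurve p) (j : ι) (C : ℝ) :
    IsClosed {w | ‖p w‖ ≤ C * ‖p w j‖} ∧ IsClosed {w | C * ‖p w j‖ ≤ ‖p w‖} := by
  have key : ∀ w, ∃ y : ℂ → ι → ℂ, ContinuousAt y w ∧ ∀ᶠ z in 𝓝 w, ∃ c > 0,
      ‖p z‖ = c * ‖y z‖ ∧ ‖p z j‖ = c * ‖y z j‖ := by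
    intro w
    obtain ⟨k, hk⟩ := hp.exists_ne_zero w
    refine ⟨chart p k, ((hp w).2 k hk).continuousAt, ?_⟩
    filter_upwards [hp.eventually_ne_zero hk] with z hz
    refine ⟨‖p z k‖, norm_pos_iff.2 hz, ?_, ?_⟩
    · rw [← norm_smul, ← eq_smul_chart hz]
    · rw [← norm_mul, ← smul_eq_mul, ← Pi.smul_apply, ← eq_smul_chart hz]
  constructor
  · refine ⟨isOpen_iff_mem_nhds.2 fun w hw => ?_⟩
    obtain ⟨y, hy, hev⟩ := key w
    have hyj : ContinuousAt (fun z => C * ‖y z j‖) w :=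
      (((continuous_apply j).continuousAt.comp hy).norm).const_mul C
    obtain ⟨c, hc, h1, h2⟩ := hev.self_of_nhds
    have hlt : C * ‖y w j‖ < ‖y w‖ := by
      simp only [Set.mem_compl_iff, Set.mem_ofPred_eq, not_le, h1, h2] at hw
      exact lt_of_mul_lt_mul_left (by linarith) hc.le
    filter_upwards [hev, hyj.eventually_lt hy.norm hlt] with z ⟨c, hc, h1, h2⟩ hz
    simp only [Set.mem_compl_iff, Set.mem_ofPred_eq, not_le, h1, h2]
    nlinarith
  · refine ⟨isOpen_iff_mem_nhds.2 fun w hw => ?_⟩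
    obtain ⟨y, hy, hev⟩ := key w
    have hyj : ContinuousAt (fun z => C * ‖y z j‖) w :=
      (((continuous_apply j).continuousAt.comp hy).norm).const_mul C
    obtain ⟨c, hc, h1, h2⟩ := hev.self_of_nhds
    have hlt : ‖y w‖ < C * ‖y w j‖ := by
      simp only [Set.mem_compl_iff, Set.mem_ofPred_eq, not_le, h1, h2] at hw
      exact lt_of_mul_lt_mul_left (by linarith) hc.le
    filter_upwards [hev, hy.norm.eventually_lt hyj hlt] with z ⟨c, hc, h1, h2⟩ hz
    simp only [Set.mem_compl_iff, Set.mem_ofPred_eq, not_le, h1, h2]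
    nlinarith

variable [Nonempty ι]

/-- A curve whose speed is at most `M` stays in a bounded part of an affine chart on discs of
radius `1 / (8 * M)`. -/
theorem IsProjCurve.norm_le_two_mul {p : ℂ → ι → ℂ} (hp : IsProjCurve p) {w₀ : ℂ} {j : ι}
    {δ M : ℝ} (hj : ‖p w₀ j‖ = ‖p w₀‖) (hM : ∀ w ∈ Metric.ball w₀ δ, speed p w ≤ M)
    (hδ : 8 * M * δ ≤ 1) (hM0 : 0 < M) {w : ℂ} (hw : w ∈ Metric.ball w₀ δ) :
    ‖p w‖ ≤ 2 * ‖p w j‖ := by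
  have hp0 : 0 < ‖p w₀‖ := norm_pos_iff.2 (hp w₀).1
  set γ : ℝ → ℂ := fun τ => w₀ + τ * (w - w₀) with hγ
  have hγc : Continuous γ := by fun_prop
  have hnear : ∀ τ ∈ Set.Icc (0 : ℝ) 1, ‖γ τ - w₀‖ < δ := by
    intro τ hτ
    rw [Metric.mem_ball, dist_eq_norm] at hw
    simp only [hγ, add_sub_cancel_left, norm_mul, Complex.norm_real, Real.norm_eq_abs,
      abs_of_nonneg hτ.1]
    nlinarith [norm_nonneg (w - w₀), hτ.2]
  set B : Set ℝ := Set.Icc 0 1 ∩ γ ⁻¹' {z | 2 * ‖p z j‖ ≤ ‖p z‖} with hB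
  have hBc : IsCompact B := isCompact_Icc.inter_right ((hp.isClosed_norm_le j 2).2.preimage hγc)
  suffices hBe : B = ∅ by
    by_contra hcon
    have : (1 : ℝ) ∈ B := ⟨by simp, by simpa [hγ] using (not_le.1 hcon).le⟩
    simp [hBe] at this
  by_contra hne
  obtain ⟨τ, ⟨hτ, hτbad⟩, hτmin⟩ := hBc.exists_isLeast (Set.nonempty_iff_ne_empty.2 hne)
  have hτ0 : 0 < τ := by
    rcases hτ.1.eq_or_lt with h | h
    · exfalso
      simp only [← h, hγ, Set.mem_preimage, Set.mem_ofPred_eq, Complex.ofReal_zero, zero_mul,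
        add_zero, hj] at hτbad
      linarith
    · exact h
  have hgood' : ∀ σ ∈ Set.Ico 0 τ, ‖p (γ σ)‖ ≤ 2 * ‖p (γ σ) j‖ := by
    intro σ hσ
    by_contra hcon
    exact absurd (hτmin ⟨⟨hσ.1, hσ.2.le.trans hτ.2⟩, (not_le.1 hcon).le⟩) (not_le.2 hσ.2)
  have hgood : ∀ σ ∈ Set.Icc 0 τ, ‖p (γ σ)‖ ≤ 2 * ‖p (γ σ) j‖ := by
    have hcl : IsClosed (γ ⁻¹' {z | ‖p z‖ ≤ 2 * ‖p z j‖}) :=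
      (hp.isClosed_norm_le j 2).1.preimage hγc
    have := closure_minimal (fun σ hσ => hgood' σ hσ) hcl
    rwa [closure_Ico hτ0.ne] at this
  have hgood_seg : ∀ z ∈ segment ℝ w₀ (γ τ), ‖p z‖ ≤ 2 * ‖p z j‖ ∧ ‖z - w₀‖ < δ := by
    intro z hz
    rw [segment_eq_image'] at hz
    obtain ⟨θ, hθ, rfl⟩ := hz
    have : w₀ + θ • (γ τ - w₀) = γ (θ * τ) := by simp [hγ]; ring
    simp only [this]
    have hmem : θ * τ ∈ Set.Icc 0 τ := ⟨mul_nonneg hθ.1 hτ.1, by nlinarith [hθ.2]⟩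
    exact ⟨hgood _ hmem, hnear _ ⟨hmem.1, hmem.2.trans hτ.2⟩⟩
  have hne_of : ∀ z, ‖p z‖ ≤ 2 * ‖p z j‖ → p z j ≠ 0 := by
    intro z hz h0
    rw [h0, norm_zero, mul_zero] at hz
    exact (hp z).1 (norm_le_zero_iff.1 hz)
  have hbound : ∀ z ∈ segment ℝ w₀ (γ τ), ‖deriv (chart p j) z‖ ≤ 8 * M := by
    intro z hz
    obtain ⟨h1, h2⟩ := hgood_seg z hz
    have hzj := hne_of z h1
    have h3 : ‖chart p j z‖ ≤ 2 := by
      rw [norm_chart, div_le_iff₀ (norm_pos_iff.2 hzj)]; exact h1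
    have h4 := hM z (by rwa [Metric.mem_ball, dist_eq_norm])
    calc _ ≤ 2 * speed p z * ‖chart p j z‖ ^ 2 := hp.norm_deriv_chart_le_speed hzj
      _ ≤ 2 * M * 2 ^ 2 := by gcongr
      _ = 8 * M := by ring
  have hmvt := (convex_segment w₀ (γ τ)).norm_image_sub_le_of_norm_deriv_le
    (fun z hz => ((hp z).2 j (hne_of z (hgood_seg z hz).1)).differentiableAt) hbound
    (left_mem_segment ℝ _ _) (right_mem_segment ℝ _ _)
  have h5 : ‖chart p j w₀‖ = 1 := by rw [norm_chart, hj, div_self hp0.ne']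
  have h6 : ‖chart p j (γ τ)‖ < 2 := by
    have : ‖chart p j (γ τ)‖ ≤ ‖chart p j (γ τ) - chart p j w₀‖ + ‖chart p j w₀‖ := by
      simpa using norm_add_le (chart p j (γ τ) - chart p j w₀) (chart p j w₀)
    have h7 := hnear τ hτ
    nlinarith
  have hτj := norm_pos_iff.2 (hne_of _ (hgood τ ⟨hτ.1, le_rfl⟩))
  rw [norm_chart, div_lt_iff₀ hτj] at h6
  exact absurd hτbad (not_le.2 h6)

/-- Brody's reparametrisation: an affine change of parameter makes the speed equal to `1` at the
origin and bounded on a given disc. -/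
theorem IsProjCurve.exists_rescale {p : ℂ → ι → ℂ} (hp : IsProjCurve p) (hn : ¬ IsProjConst p)
    (n : ℕ) : ∃ a b : ℂ, speed (fun z => p (a + b * z)) 0 = 1 ∧
      ∀ z ∈ Metric.closedBall (0 : ℂ) n, speed (fun z => p (a + b * z)) z ≤ 4 := by
  obtain ⟨w₀, hw₀⟩ : ∃ w₀, speed p w₀ ≠ 0 := by
    by_contra! h
    exact hn (hp.isProjConst_of_speed_eq_zero h)
  have hs : 0 < speed p w₀ := (speed_nonneg p w₀).lt_of_ne' hw₀
  set R : ℝ := ‖w₀‖ + (4 * n + 1) / speed p w₀ with hR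
  obtain ⟨M, hM⟩ := hp.exists_speed_le R
  set S : Set ℝ := (fun w => (R - ‖w‖) * speed p w) '' Metric.closedBall 0 R with hS
  have hRw : (R - ‖w₀‖) * speed p w₀ = 4 * n + 1 := by rw [hR]; field_simp; ring
  have hw₀R : ‖w₀‖ ≤ R := by rw [hR]; have : 0 ≤ (4 * (n : ℝ) + 1) / speed p w₀ := by positivity
                             linarith
  have hS0 : (4 * n + 1 : ℝ) ∈ S := ⟨w₀, by simpa using hw₀R, hRw⟩
  have hSb : BddAbove S := by
    refine ⟨R * M, ?_⟩
    rintro _ ⟨w, hw, rfl⟩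
    have h1 := hM w hw
    have h2 := speed_nonneg p w
    rw [mem_closedBall_zero_iff] at hw
    have := norm_nonneg w
    exact mul_le_mul (by linarith) h1 h2 (by linarith)
  have hB : 4 * n + 1 ≤ sSup S := le_csSup hSb hS0
  have hnn : (0 : ℝ) ≤ n := n.cast_nonneg
  obtain ⟨_, ⟨a, ha, rfl⟩, hlt⟩ := exists_lt_of_lt_csSup ⟨_, hS0⟩
    (show sSup S / 2 < sSup S by linarith)
  simp only at hlt
  rw [mem_closedBall_zero_iff] at ha
  have hρ : 0 < speed p a := by
    refine (speed_nonneg p a).lt_of_ne fun h => ?_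
    rw [← h, mul_zero] at hlt
    linarith
  have hRa : 0 < R - ‖a‖ := by
    by_contra hcon
    nlinarith
  refine ⟨a, ((speed p a)⁻¹ : ℝ), ?_, fun z hz => ?_⟩
  · rw [speed_comp_affine, mul_zero, add_zero, Complex.norm_real, norm_inv, Real.norm_eq_abs,
      abs_of_pos hρ, inv_mul_cancel₀ hρ.ne']
  · rw [mem_closedBall_zero_iff] at hz
    rw [speed_comp_affine, Complex.norm_real, norm_inv, Real.norm_eq_abs, abs_of_pos hρ]
    set w := a + ((speed p a)⁻¹ : ℝ) * z with hw
    have h1 : ‖w‖ ≤ ‖a‖ + (speed p a)⁻¹ * ‖z‖ := by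
      refine (norm_add_le _ _).trans_eq ?_
      rw [norm_mul, Complex.norm_real, norm_inv, Real.norm_eq_abs, abs_of_pos hρ]
    have h2 : (speed p a)⁻¹ * ‖z‖ ≤ (R - ‖a‖) / 2 := by
      rw [inv_mul_le_iff₀ hρ]
      nlinarith
    have h3 : (R - ‖w‖) * speed p w ≤ sSup S :=
      le_csSup hSb ⟨w, by rw [mem_closedBall_zero_iff]; linarith, rfl⟩
    have h4 : (R - ‖a‖) / 2 * speed p w ≤ 2 * ((R - ‖a‖) * speed p a) := by
      have := speed_nonneg p w
      nlinarith
    rw [inv_mul_le_iff₀ hρ]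
    nlinarith

/-- Local convergence in charts of a family of projective curves along a filter. -/
def ChartLimit (l : Filter ℕ) (g : ℕ → ℂ → ι → ℂ) (p : ℂ → ι → ℂ) : Prop :=
  ∀ w, ∃ j, ∃ r > 0, ‖chart p j w‖ ≤ 1 ∧ (∀ᶠ k in l, ∀ z ∈ Metric.ball w r, g k z j ≠ 0) ∧
    ∀ z ∈ Metric.ball w r, p z j ≠ 0 ∧
      Tendsto (fun x : ℕ × ℂ => chart (g x.1) j x.2) (l ×ˢ 𝓝 z) (𝓝 (chart p j z))

/-- Pointwise limits along an ultrafilter of bounded equi-Lipschitz functions. -/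
theorem exists_ultrafilter_limit {E : Type*} [NormedAddCommGroup E] [ProperSpace E]
    (l : Ultrafilter ℕ) (f : ℕ → ℂ → E) (w : ℂ) (r : ℝ) (C L : ℝ)
    (hC : ∀ᶠ k in l, ∀ z ∈ Metric.ball w r, ‖f k z‖ ≤ C)
    (hL : ∀ᶠ k in l, ∀ z ∈ Metric.ball w r, ∀ z' ∈ Metric.ball w r,
      ‖f k z - f k z'‖ ≤ L * ‖z - z'‖) :
    ∃ F : ℂ → E, ∀ z ∈ Metric.ball w r,
      Tendsto (fun x : ℕ × ℂ => f x.1 x.2) (l ×ˢ 𝓝 z) (𝓝 (F z)) := by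
  have hpt : ∀ z, ∃ y, z ∈ Metric.ball w r → Tendsto (fun k => f k z) l (𝓝 y) := by
    intro z
    by_cases hz : z ∈ Metric.ball w r
    · obtain ⟨y, -, hy⟩ := (isCompact_closedBall (0 : E) C).ultrafilter_le_nhds'
        (l.map fun k => f k z) (Filter.mem_map.2 (by
          filter_upwards [hC] with k hk
          simpa using hk z hz))
      exact ⟨y, fun _ => hy⟩
    · exact ⟨0, fun h => absurd h hz⟩
  choose F hF using hpt
  refine ⟨F, fun z hz => ?_⟩
  have h1 : Tendsto (fun x : ℕ × ℂ => f x.1 z) (l ×ˢ 𝓝 z) (𝓝 (F z)) :=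
    (hF z hz).comp tendsto_fst
  have h2 : Tendsto (fun x : ℕ × ℂ => f x.1 x.2 - f x.1 z) (l ×ˢ 𝓝 z) (𝓝 0) := by
    refine squeeze_zero_norm' (a := fun x => L * ‖x.2 - z‖) ?_ ?_
    · have hz' : ∀ᶠ z' in 𝓝 z, z' ∈ Metric.ball w r := Metric.isOpen_ball.mem_nhds hz
      filter_upwards [hL.prod_mk hz'] with x hx
      exact hx.1 _ hx.2 _ hz
    · have : Tendsto (fun u : ℂ => L * ‖u - z‖) (𝓝 z) (𝓝 0) := by
        have : Continuous fun u : ℂ => L * ‖u - z‖ := by fun_prop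
        simpa using this.tendsto z
      exact this.comp tendsto_snd
  simpa using h2.add h1

end EntireCurve

namespace EntireCurve

variable {ι : Type*} [Fintype ι]

theorem tendsto_of_tendsto_prod {E : Type*} [TopologicalSpace E] {l : Filter ℕ}
    {F : ℕ → ℂ → E} {y : E} {z : ℂ}
    (h : Tendsto (fun x : ℕ × ℂ => F x.1 x.2) (l ×ˢ 𝓝 z) (𝓝 y)) :
    Tendsto (fun k => F k z) l (𝓝 y) :=
  h.comp (tendsto_id.prodMk tendsto_const_nhds)

theorem tendstoLocallyUniformlyOn_of_tendsto_prod {E : Type*} [NormedAddCommGroup E]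
    {l : Filter ℕ} [l.NeBot] {F : ℕ → ℂ → E} {f : ℂ → E} {s : Set ℂ}
    (h : ∀ z ∈ s, Tendsto (fun x : ℕ × ℂ => F x.1 x.2) (l ×ˢ 𝓝 z) (𝓝 (f z))) :
    TendstoLocallyUniformlyOn F f l s := by
  rw [Metric.tendstoLocallyUniformlyOn_iff]
  intro ε hε z hz
  obtain ⟨a, ha, b, hb, hab⟩ := eventually_prod_iff.1
    ((h z hz).eventually (Metric.ball_mem_nhds (f z) (show 0 < ε / 4 by positivity)))
  refine ⟨{z' | b z'} ∩ s, inter_mem (mem_nhdsWithin_of_mem_nhds hb) self_mem_nhdsWithin, ?_⟩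
  filter_upwards [ha] with k hk z' hz'
  have h1 : dist (f z') (f z) ≤ ε / 4 :=
    le_of_tendsto ((tendsto_of_tendsto_prod (h z' hz'.2)).dist tendsto_const_nhds)
      (ha.mono fun k hk => (hab hk hz'.1).le)
  have h2 : dist (F k z') (f z) < ε / 4 := hab hk hz'.1
  linarith [dist_triangle_right (f z') (F k z') (f z)]

theorem ChartLimit.tendstoLocallyUniformlyOn {l : Filter ℕ} [l.NeBot] {g : ℕ → ℂ → ι → ℂ}
    {p : ℂ → ι → ℂ} (hg : ∀ k, IsProjCurve (g k)) (h : ChartLimit l g p) (w : ℂ) :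
    ∃ j, ∃ r > 0, ‖chart p j w‖ ≤ 1 ∧ (∀ᶠ k in l, ∀ z ∈ Metric.ball w r, g k z j ≠ 0) ∧
      (∀ z ∈ Metric.ball w r, p z j ≠ 0) ∧
      (∀ᶠ k in l, DifferentiableOn ℂ (chart (g k) j) (Metric.ball w r)) ∧
      DifferentiableOn ℂ (chart p j) (Metric.ball w r) ∧
      TendstoLocallyUniformlyOn (fun k => chart (g k) j) (chart p j) l (Metric.ball w r) := by
  obtain ⟨j, r, hr, h1, h2, h3⟩ := h w
  have h4 := tendstoLocallyUniformlyOn_of_tendsto_prod (F := fun k => chart (g k) j)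
    (f := chart p j) fun z hz => (h3 z hz).2
  have h5 : ∀ᶠ k in l, DifferentiableOn ℂ (chart (g k) j) (Metric.ball w r) := by
    filter_upwards [h2] with k hk z hz
    exact ((hg k z).2 j (hk z hz)).differentiableAt.differentiableWithinAt
  exact ⟨j, r, hr, h1, h2, fun z hz => (h3 z hz).1, h5,
    h4.differentiableOn h5 Metric.isOpen_ball, h4⟩

theorem ChartLimit.isProjCurve {l : Filter ℕ} [l.NeBot] {g : ℕ → ℂ → ι → ℂ}
    {p : ℂ → ι → ℂ} (hg : ∀ k, IsProjCurve (g k)) (h : ChartLimit l g p) : IsProjCurve p := by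
  refine isProjCurve_of_lift fun w => ?_
  obtain ⟨j, r, hr, -, -, h1, -, h2, -⟩ := h.tendstoLocallyUniformlyOn hg w
  have hw := Metric.ball_mem_nhds w hr
  refine ⟨chart p j, h2.analyticAt hw, chart_ne_zero (h1 w (Metric.mem_ball_self hr)), ?_⟩
  filter_upwards [hw] with z hz
  exact ⟨p z j, h1 z hz, eq_smul_chart (h1 z hz)⟩

theorem IsProjConst.deriv_chart_eq_zero {p : ℂ → ι → ℂ} (hp : IsProjCurve p)
    (h : IsProjConst p) (j : ι) (w : ℂ) : deriv (chart p j) w = 0 := by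
  have : chart p j = fun _ => chart p j w := by
    funext z
    obtain ⟨c, hc⟩ := h w z
    have hc0 : c ≠ 0 := fun h0 => (hp z).1 (by simp [hc, h0])
    exact chart_smul (q := fun _ => p w) hc0 hc j
  rw [this, deriv_const]

variable [Nonempty ι]

/-- Normal-family compactness: uniformly bounded speed yields limits along ultrafilters. -/
theorem exists_chartLimit (l : Ultrafilter ℕ) {g : ℕ → ℂ → ι → ℂ}
    (hg : ∀ k, IsProjCurve (g k))
    (hM : ∀ w, ∀ᶠ k in l, ∀ z ∈ Metric.ball w 1, speed (g k) z ≤ 4) :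
    ∃ p, ChartLimit l g p := by
  set δ : ℝ := 1 / 32 with hδ
  have hδ0 : 0 < δ := by norm_num [hδ]
  have key : ∀ w, ∃ (j : ι) (Y : ℂ → ι → ℂ), ‖Y w‖ ≤ 1 ∧
      (∀ᶠ k in l, ∀ z ∈ Metric.ball w δ, ‖g k z‖ ≤ 2 * ‖g k z j‖) ∧
      ∀ z ∈ Metric.ball w δ,
        Tendsto (fun x : ℕ × ℂ => chart (g x.1) j x.2) (l ×ˢ 𝓝 z) (𝓝 (Y z)) := by
    intro w
    obtain ⟨j, hj⟩ := Ultrafilter.eventually_exists_iff.1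
      (Eventually.of_forall fun k => ⟨topCoord (g k w), rfl⟩ :
        ∀ᶠ k in l, ∃ j, topCoord (g k w) = j)
    have h1 : ∀ᶠ k in l, ∀ z ∈ Metric.ball w δ, ‖g k z‖ ≤ 2 * ‖g k z j‖ := by
      filter_upwards [hM w, hj] with k hk hkj z hz
      refine (hg k).norm_le_two_mul (M := 4) (by rw [← hkj, norm_topCoord]) (fun u hu => hk u ?_)
        (by norm_num [hδ]) (by norm_num) hz
      exact Metric.ball_subset_ball (by norm_num [hδ]) hu
    have hne : ∀ k z, ‖g k z‖ ≤ 2 * ‖g k z j‖ → g k z j ≠ 0 := by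
      intro k z hz h0
      rw [h0, norm_zero, mul_zero] at hz
      exact (hg k z).1 (norm_le_zero_iff.1 hz)
    have h2 : ∀ᶠ k in l, ∀ z ∈ Metric.ball w δ, ‖chart (g k) j z‖ ≤ 2 := by
      filter_upwards [h1] with k hk z hz
      rw [norm_chart, div_le_iff₀ (norm_pos_iff.2 (hne k z (hk z hz)))]
      exact hk z hz
    have h3 : ∀ᶠ k in l, ∀ z ∈ Metric.ball w δ, ∀ z' ∈ Metric.ball w δ,
        ‖chart (g k) j z - chart (g k) j z'‖ ≤ 32 * ‖z - z'‖ := by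
      filter_upwards [h1, h2, hM w] with k hk1 hk2 hk3 z hz z' hz'
      refine (convex_ball w δ).norm_image_sub_le_of_norm_deriv_le
        (fun u hu => ((hg k u).2 j (hne k u (hk1 u hu))).differentiableAt) (fun u hu => ?_) hz' hz
      have h4 := hk3 u (Metric.ball_subset_ball (by norm_num [hδ]) hu)
      have h5 := hk2 u hu
      calc _ ≤ 2 * speed (g k) u * ‖chart (g k) j u‖ ^ 2 :=
            (hg k).norm_deriv_chart_le_speed (hne k u (hk1 u hu))
        _ ≤ 2 * 4 * 2 ^ 2 := by gcongr
        _ = 32 := by norm_num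
    obtain ⟨Y, hY⟩ := exists_ultrafilter_limit l (fun k => chart (g k) j) w δ 2 32 h2 h3
    refine ⟨j, Y, ?_, h1, hY⟩
    refine le_of_tendsto (tendsto_of_tendsto_prod
      (F := fun k => chart (g k) j) (hY w (Metric.mem_ball_self hδ0))).norm ?_
    filter_upwards [hj] with k hk
    rw [← hk, (hg k).norm_chart_topCoord]
  choose J Y hY1 hY2 hY3 using key
  have hne : ∀ w, ∀ᶠ k in l, ∀ z ∈ Metric.ball w δ, g k z (J w) ≠ 0 := by
    intro w
    filter_upwards [hY2 w] with k hk z hz h0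
    have := hk z hz
    rw [h0, norm_zero, mul_zero] at this
    exact (hg k z).1 (norm_le_zero_iff.1 this)
  have hpt : ∀ w, ∀ z ∈ Metric.ball w δ,
      Tendsto (fun k => chart (g k) (J w) z) l (𝓝 (Y w z)) := fun w z hz =>
    tendsto_of_tendsto_prod (F := fun k => chart (g k) (J w)) (hY3 w z hz)
  set p : ℂ → ι → ℂ := fun w => Y w w with hp
  have hself : ∀ z : ℂ, z ∈ Metric.ball z δ := fun z => Metric.mem_ball_self hδ0
  have hmain : ∀ w, ∀ z ∈ Metric.ball w δ, p z (J w) ≠ 0 ∧ chart p (J w) z = Y w z := by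
    intro w z hz
    have h1 : Tendsto (fun k => chart (g k) (J z) z (J w)) l (𝓝 (p z (J w))) :=
      tendsto_pi_nhds.1 (hpt z z (hself z)) (J w)
    have h2 : 1 / 2 ≤ ‖p z (J w)‖ := by
      refine ge_of_tendsto h1.norm ?_
      filter_upwards [hY2 w, hne z] with k hk hk'
      have h3 := norm_pos_iff.2 (hk' z (hself z))
      have h4 : ‖chart (g k) (J z) z (J w)‖ = ‖g k z (J w)‖ / ‖g k z (J z)‖ := by
        simp [chart]; ring
      rw [h4, le_div_iff₀ h3]
      linarith [hk z hz, norm_le_pi_norm (g k z) (J z)]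
    have h3 : p z (J w) ≠ 0 := norm_pos_iff.1 (by linarith)
    refine ⟨h3, tendsto_nhds_unique ?_ (hpt w z hz)⟩
    have h4 := (h1.inv₀ h3).smul (hpt z z (hself z))
    refine h4.congr' ?_
    filter_upwards [hne z] with k hk
    exact (chart_eq_inv_smul_chart (hk z (hself z)) (J w)).symm
  refine ⟨p, fun w => ⟨J w, δ, hδ0, ?_, hne w, fun z hz => ⟨(hmain w z hz).1, ?_⟩⟩⟩
  · rw [(hmain w w (hself w)).2]
    exact hY1 w
  · rw [(hmain w z hz).2]
    exact hY3 w z hz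

/-- Brody's reparametrisation theorem for sequences of curves in projective space. -/
theorem exists_brody_limit {h : ℕ → ℂ → ι → ℂ} (hh : ∀ k, IsProjCurve (h k))
    (hn : ∀ k, ¬ IsProjConst (h k)) :
    ∃ (l : Filter ℕ) (g : ℕ → ℂ → ι → ℂ) (p : ℂ → ι → ℂ), l.NeBot ∧ l ≤ atTop ∧
      (∀ k, IsProjCurve (g k)) ∧ (∀ k z, ∃ w, g k z = h k w) ∧ ChartLimit l g p ∧
      IsProjCurve p ∧ ¬ IsProjConst p ∧ ∀ w, speed p w ≤ 16 := by
  choose a b hab1 hab2 using fun k => (hh k).exists_rescale (hn k) k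
  set g : ℕ → ℂ → ι → ℂ := fun k z => h k (a k + b k * z) with hgdef
  have hg : ∀ k, IsProjCurve (g k) := fun k => (hh k).comp_affine (a k) (b k)
  have hl : (hyperfilter ℕ : Filter ℕ) ≤ atTop := Nat.hyperfilter_le_atTop
  have hM : ∀ w, ∀ᶠ k in (hyperfilter ℕ : Filter ℕ), ∀ z ∈ Metric.ball w 1,
      speed (g k) z ≤ 4 := by
    intro w
    obtain ⟨N, hN⟩ := exists_nat_ge (‖w‖ + 1)
    filter_upwards [hl (eventually_ge_atTop N)] with k hk z hz
    refine hab2 k z ?_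
    have hk' : (N : ℝ) ≤ k := by exact_mod_cast hk
    rw [mem_closedBall_zero_iff]
    rw [Metric.mem_ball, dist_eq_norm] at hz
    linarith [norm_le_norm_add_norm_sub' z w]
  obtain ⟨p, hp⟩ := exists_chartLimit (hyperfilter ℕ) hg hM
  have hpc := hp.isProjCurve hg
  have hder : ∀ w, ∃ j, p w j ≠ 0 ∧ ‖chart p j w‖ ≤ 1 ∧
      (∀ᶠ k in (hyperfilter ℕ : Filter ℕ), g k w j ≠ 0) ∧
      Tendsto (fun k => chart (g k) j w) (hyperfilter ℕ) (𝓝 (chart p j w)) ∧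
      Tendsto (fun k => deriv (chart (g k) j) w) (hyperfilter ℕ) (𝓝 (deriv (chart p j) w)) := by
    intro w
    obtain ⟨j, r, hr, h1, h2, h3, h4, h5, h6⟩ := hp.tendstoLocallyUniformlyOn hg w
    have hw : w ∈ Metric.ball w r := Metric.mem_ball_self hr
    exact ⟨j, h3 w hw, h1, h2.mono fun k hk => hk w hw, h6.tendsto_at hw,
      (h6.deriv h4 Metric.isOpen_ball).tendsto_at hw⟩
  refine ⟨hyperfilter ℕ, g, p, inferInstance, hl, hg, fun k z => ⟨_, rfl⟩, hp, hpc, fun hc => ?_,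
    fun w => ?_⟩
  · obtain ⟨j, -, -, h3, -, h5⟩ := hder 0
    rw [hc.deriv_chart_eq_zero hpc] at h5
    have : (1 / 2 : ℝ) ≤ ‖(0 : ι → ℂ)‖ := by
      refine ge_of_tendsto h5.norm ?_
      filter_upwards [h3] with k hk
      have := (hg k).speed_le hk
      rw [hab1 k] at this
      linarith
    norm_num at this
  · obtain ⟨j, h1, h2, h3, h4, h5⟩ := hder w
    have h6 : ‖deriv (chart p j) w‖ ≤ 8 * ‖chart p j w‖ ^ 2 := by
      refine le_of_tendsto_of_tendsto h5.norm ((h4.norm.pow 2).const_mul 8) ?_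
      filter_upwards [h3, hM w] with k hk hk'
      refine ((hg k).norm_deriv_chart_le_speed hk).trans ?_
      gcongr
      linarith [hk' w (Metric.mem_ball_self one_pos)]
    have h7 := hpc.speed_le h1
    nlinarith [norm_nonneg (chart p j w)]

end EntireCurve

namespace EntireCurve

variable {ι : Type*} [Fintype ι]

theorem eval_smul_of_isHomogeneous {Q : MvPolynomial ι ℂ} {d : ℕ} (hQ : Q.IsHomogeneous d) (c : ℂ)
    (x : ι → ℂ) : eval (c • x) Q = c ^ d * eval x Q := by
  rw [eval_eq', eval_eq', Finset.mul_sum]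
  refine Finset.sum_congr rfl fun e he => ?_
  have h1 : ∑ i, e i = d := by
    have := hQ (mem_support_iff.1 he)
    simpa [Finsupp.weight_apply, Finsupp.sum_fintype] using this
  simp only [Pi.smul_apply, smul_eq_mul, mul_pow, Finset.prod_mul_distrib,
    Finset.prod_pow_eq_pow_sum, h1]
  ring

theorem analyticAt_eval (Q : MvPolynomial ι ℂ) {H : ℂ → ι → ℂ} {w : ℂ} (hH : AnalyticAt ℂ H w) :
    AnalyticAt ℂ (fun z => eval (H z) Q) w := by
  simpa [aeval_eq_eval] using
    AnalyticAt.aeval_mvPolynomial (fun i => analyticAt_apply_coord hH i) Q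

/-- The identity theorem for the zero set of a function which locally has the same zeros as an
analytic function. -/
theorem eq_zero_or_eventually_ne_zero {A : ℂ → ℂ}
    (h : ∀ w, ∃ G : ℂ → ℂ, AnalyticAt ℂ G w ∧ ∀ᶠ z in 𝓝 w, (A z = 0 ↔ G z = 0)) :
    (∀ w, A w = 0) ∨ ∀ w, ∀ᶠ z in 𝓝[≠] w, A z ≠ 0 := by
  have hloc : ∀ w, (∀ᶠ z in 𝓝 w, A z = 0) ∨ ∀ᶠ z in 𝓝[≠] w, A z ≠ 0 := by
    intro w
    obtain ⟨G, hG, hev⟩ := h w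
    refine hG.eventually_eq_zero_or_eventually_ne_zero.imp (fun h1 => ?_) fun h1 => ?_
    · filter_upwards [h1, hev] with z hz hz' using hz'.2 hz
    · filter_upwards [h1, hev.filter_mono nhdsWithin_le_nhds] with z hz hz' h0 using hz (hz'.1 h0)
  by_cases hS : ∃ w, ∀ᶠ z in 𝓝 w, A z = 0
  · left
    have hcl : IsClopen {w | ∀ᶠ z in 𝓝 w, A z = 0} := by
      refine ⟨⟨isOpen_iff_mem_nhds.2 fun w hw => ?_⟩, isOpen_iff_mem_nhds.2 fun w hw =>
        eventually_eventually_nhds.2 hw⟩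
      have h1 := (hloc w).resolve_left hw
      rw [eventually_nhdsWithin_iff] at h1
      filter_upwards [h1] with z hz hz'
      rcases eq_or_ne z w with rfl | hne
      · exact hw hz'
      · exact hz hne hz'.self_of_nhds
    intro w
    exact (Set.eq_univ_iff_forall.1 (hcl.eq_univ hS) w).self_of_nhds
  · rw [not_exists] at hS
    exact Or.inr fun w => (hloc w).resolve_left (hS w)

theorem IsProjCurve.eval_eq_zero_or {p : ℂ → ι → ℂ} (hp : IsProjCurve p) {Q : MvPolynomial ι ℂ}
    {d : ℕ} (hQ : Q.IsHomogeneous d) :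
    (∀ w, eval (p w) Q = 0) ∨ ∀ w, ∀ᶠ z in 𝓝[≠] w, eval (p z) Q ≠ 0 := by
  refine eq_zero_or_eventually_ne_zero fun w => ?_
  obtain ⟨j, hj⟩ := hp.exists_ne_zero w
  refine ⟨fun z => eval (chart p j z) Q, analyticAt_eval Q ((hp w).2 j hj), ?_⟩
  filter_upwards [hp.eventually_ne_zero hj] with z hz
  simp [chart, eval_smul_of_isHomogeneous hQ, hz]

/-- Hurwitz's theorem. -/
theorem eventually_eq_zero_of_tendstoLocallyUniformlyOn {l : Filter ℕ} [l.NeBot]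
    {G : ℕ → ℂ → ℂ} {f : ℂ → ℂ} {w : ℂ} {r : ℝ} (hr : 0 < r)
    (hd : ∀ᶠ k in l, DifferentiableOn ℂ (G k) (Metric.ball w r))
    (h0 : ∀ᶠ k in l, ∀ z ∈ Metric.ball w r, G k z ≠ 0)
    (hlim : TendstoLocallyUniformlyOn G f l (Metric.ball w r)) (hf : f w = 0) :
    ∀ᶠ z in 𝓝 w, f z = 0 := by
  have hfd : DifferentiableOn ℂ f (Metric.ball w r) :=
    hlim.differentiableOn hd Metric.isOpen_ball
  refine (hfd.analyticAt (Metric.ball_mem_nhds w hr)).eventually_eq_zero_or_eventually_ne_zero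
    |>.resolve_right fun hne => ?_
  rw [eventually_nhdsWithin_iff, Metric.eventually_nhds_iff_ball] at hne
  obtain ⟨s, hs, hne⟩ := hne
  set ρ := min r s / 2 with hρ
  have hm : 0 < min r s := lt_min hr hs
  have hρ0 : 0 < ρ := by positivity
  have hρr : ρ < r := by linarith [min_le_left r s]
  have hρs : ρ < s := by linarith [min_le_right r s]
  have hsub : Metric.closedBall w ρ ⊆ Metric.ball w r := Metric.closedBall_subset_ball hρr
  have hsph : Metric.sphere w ρ ⊆ Metric.ball w r := Metric.sphere_subset_closedBall.trans hsub
  obtain ⟨c, hc, hcf⟩ : ∃ c > 0, ∀ z ∈ Metric.sphere w ρ, c ≤ ‖f z‖ := by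
    obtain ⟨z₀, hz₀, hmin⟩ := (isCompact_sphere w ρ).exists_isMinOn
      (NormedSpace.sphere_nonempty.2 hρ0.le) (hfd.continuousOn.mono hsph).norm
    refine ⟨‖f z₀‖, norm_pos_iff.2 (hne z₀ ?_ ?_), fun z hz => hmin hz⟩
    · exact Metric.sphere_subset_ball hρs hz₀
    · exact Metric.ne_of_mem_sphere hz₀ hρ0.ne'
  have hunif := (tendstoLocallyUniformlyOn_iff_forall_isCompact Metric.isOpen_ball).1 hlim _ hsph
    (isCompact_sphere w ρ)
  have hb : ∀ᶠ k in l, c / 2 ≤ ‖G k w‖ := by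
    filter_upwards [hd, h0, Metric.tendstoUniformlyOn_iff.1 hunif (c / 2) (by positivity)]
      with k hk1 hk2 hk3
    have h1 : DiffContOnCl ℂ (fun z => (G k z)⁻¹) (Metric.ball w ρ) := by
      refine DifferentiableOn.diffContOnCl ?_
      rw [closure_ball w hρ0.ne']
      exact (hk1.mono hsub).inv fun z hz => hk2 z (hsub hz)
    have h2 : ‖(G k w)⁻¹‖ ≤ (c / 2)⁻¹ := by
      refine Complex.norm_le_of_forall_mem_frontier_norm_le Metric.isBounded_ball h1
        (fun z hz => ?_) (subset_closure (Metric.mem_ball_self hρ0))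
      rw [frontier_ball w hρ0.ne'] at hz
      rw [norm_inv]
      refine inv_anti₀ (by positivity) ?_
      have h3 := hk3 z hz
      rw [dist_eq_norm] at h3
      have h4 := hcf z hz
      have h5 : ‖f z‖ ≤ ‖f z - G k z‖ + ‖G k z‖ := by
        simpa using norm_add_le (f z - G k z) (G k z)
      linarith
    rw [norm_inv] at h2
    exact (inv_le_inv₀ (norm_pos_iff.2 (hk2 w (Metric.mem_ball_self hr))) (by positivity)).1 h2
  have := ge_of_tendsto (hlim.tendsto_at (Metric.mem_ball_self hr)).norm hb
  rw [hf, norm_zero] at this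
  linarith

end EntireCurve

namespace EntireCurve

theorem hasDerivAt_eval {ι : Type*} [Fintype ι] (Q : MvPolynomial ι ℂ) {H : ℂ → ι → ℂ}
    {H' : ι → ℂ} {w : ℂ} (hH : HasDerivAt H H' w) :
    HasDerivAt (fun z => eval (H z) Q) (∑ i, eval (H w) (pderiv i Q) * H' i) w := by
  classical
  induction Q using MvPolynomial.induction_on with
  | C a => simpa using hasDerivAt_const w a
  | add p q hp hq =>
    simpa [add_mul, Finset.sum_add_distrib] using hp.fun_add hq
  | mul_X p i hp =>
    have := hp.fun_mul (hasDerivAt_pi.1 hH i)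
    simp only [map_mul, eval_X, Derivation.leibniz, smul_eq_mul, map_add, pderiv_X]
    refine this.congr_deriv ?_
    simp only [Finset.sum_mul, add_mul, Finset.sum_add_distrib, Pi.single_apply, apply_ite,
      map_one, map_zero, ite_mul, mul_one, mul_zero, zero_mul, Finset.sum_ite_eq,
      Finset.mem_univ, if_true]
    rw [add_comm]
    congr 1
    exact Finset.sum_congr rfl fun j _ => by ring

theorem cross_mul_eq_cross_mul {a b v : Fin 3 → ℂ} (ha : ∑ i, v i * a i = 0)
    (hb : ∑ i, v i * b i = 0) (i l : Fin 3) :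
    crossProduct a b i * v l = crossProduct a b l * v i := by
  rw [Fin.sum_univ_three] at ha hb
  fin_cases i <;> fin_cases l <;> simp [cross_apply] <;> grind

theorem norm_cross_le (a b : Fin 3 → ℂ) (i : Fin 3) :
    ‖crossProduct a b i‖ ≤ 2 * ‖a‖ * ‖b‖ := by
  have key : ∀ j k l n : Fin 3, ‖a j * b k - a l * b n‖ ≤ 2 * ‖a‖ * ‖b‖ := by
    intro j k l n
    refine (norm_sub_le _ _).trans ?_
    rw [norm_mul, norm_mul]
    have h1 := mul_le_mul (norm_le_pi_norm a j) (norm_le_pi_norm b k) (norm_nonneg _)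
      (norm_nonneg _)
    have h2 := mul_le_mul (norm_le_pi_norm a l) (norm_le_pi_norm b n) (norm_nonneg _)
      (norm_nonneg _)
    linarith
  fin_cases i <;> exact key _ _ _ _

theorem ChartLimit.eval_eq_zero {ι : Type*} [Fintype ι] {l : Filter ℕ} [l.NeBot]
    {g : ℕ → ℂ → ι → ℂ} {p : ℂ → ι → ℂ} (h : ChartLimit l g p) {Q : MvPolynomial ι ℂ} {d : ℕ}
    (hQ : Q.IsHomogeneous d) (hg : ∀ k z, eval (g k z) Q = 0) (w : ℂ) : eval (p w) Q = 0 := by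
  obtain ⟨j, r, hr, -, -, h1⟩ := h w
  obtain ⟨h2, h3⟩ := h1 w (Metric.mem_ball_self hr)
  have h4 := (MvPolynomial.continuous_eval Q).continuousAt.tendsto.comp
    (tendsto_of_tendsto_prod (F := fun k => chart (g k) j) h3)
  have h5 : (fun k => eval (chart (g k) j w) Q) = fun _ => 0 := by
    funext k
    rw [chart, eval_smul_of_isHomogeneous hQ, hg, mul_zero]
  rw [eq_smul_chart h2, eval_smul_of_isHomogeneous hQ]
  rw [Function.comp_def, h5] at h4
  rw [← tendsto_nhds_unique tendsto_const_nhds h4, mul_zero]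

section PlaneCurve

variable {F : MvPolynomial (Fin 3) ℂ} {d : ℕ} {p : ℂ → Fin 3 → ℂ}

/-- The expression in affine chart `j` of the pullback to a curve contained in the plane curve
`F = 0` of degree `d + 4` of the holomorphic differential form with coefficient `X a * X b ^ d`. -/
noncomputable def residueForm (F : MvPolynomial (Fin 3) ℂ) (d : ℕ) (p : ℂ → Fin 3 → ℂ)
    (i j a b : Fin 3) (w : ℂ) : ℂ :=
  crossProduct (chart p j w) (deriv (chart p j) w) i / eval (chart p j w) (pderiv i F) *
    chart p j w a * chart p j w b ^ d

theorem eval_chart_eq_zero (hF : F.IsHomogeneous (d + 4)) (h0 : ∀ w, eval (p w) F = 0)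
    (j : Fin 3) (w : ℂ) : eval (chart p j w) F = 0 := by
  rw [chart, eval_smul_of_isHomogeneous hF, h0, mul_zero]

theorem sum_pderiv_mul_eq_zero (hF : F.IsHomogeneous (d + 4)) {x : Fin 3 → ℂ}
    (hx : eval x F = 0) : ∑ i, eval x (pderiv i F) * x i = 0 := by
  have h := congrArg (eval x) hF.sum_X_mul_pderiv
  simp only [map_sum, map_mul, eval_X, map_nsmul, hx, smul_zero] at h
  simpa only [mul_comm] using h

theorem sum_pderiv_mul_deriv_eq_zero (hF : F.IsHomogeneous (d + 4)) (hp : IsProjCurve p)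
    (h0 : ∀ w, eval (p w) F = 0) {j : Fin 3} {w : ℂ} (hj : p w j ≠ 0) :
    ∑ i, eval (chart p j w) (pderiv i F) * deriv (chart p j) w i = 0 := by
  have h1 := hasDerivAt_eval F ((hp w).2 j hj).differentiableAt.hasDerivAt
  simp only [eval_chart_eq_zero hF h0] at h1
  exact h1.unique (hasDerivAt_const w 0)

theorem residueForm_eq (hF : F.IsHomogeneous (d + 4)) (hp : IsProjCurve p)
    (h0 : ∀ w, eval (p w) F = 0) {i j k l : Fin 3} {w : ℂ} (hj : p w j ≠ 0) (hk : p w k ≠ 0)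
    (hi : eval (chart p j w) (pderiv i F) ≠ 0) (hl : eval (chart p k w) (pderiv l F) ≠ 0)
    (a b : Fin 3) : residueForm F d p i j a b w = residueForm F d p l k a b w := by
  have hμ := inv_ne_zero (chart_apply_ne_zero hj hk)
  have hFl : (pderiv l F).IsHomogeneous (d + 3) := hF.pderiv
  have h1 := cross_mul_eq_cross_mul (sum_pderiv_mul_eq_zero hF (eval_chart_eq_zero hF h0 j w))
    (sum_pderiv_mul_deriv_eq_zero hF hp h0 hj) i l
  simp only [residueForm, hp.deriv_chart hj hk] at hl ⊢
  rw [chart_eq_inv_smul_chart hj k] at hl ⊢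
  simp only [eval_smul_of_isHomogeneous hFl, map_smul, map_add, LinearMap.smul_apply,
    cross_self, smul_zero, add_zero, Pi.smul_apply, smul_eq_mul] at hl ⊢
  set μ := (chart p j w k)⁻¹
  have hl' := right_ne_zero_of_mul hl
  rw [mul_pow]
  field_simp
  linear_combination chart p j w a * chart p j w b ^ d * μ ^ (d + 3) * h1

theorem residueForm_analyticAt (hp : IsProjCurve p) {i j : Fin 3} {w : ℂ} (hj : p w j ≠ 0)
    (hi : eval (chart p j w) (pderiv i F) ≠ 0) (a b : Fin 3) :
    AnalyticAt ℂ (residueForm F d p i j a b) w := by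
  have h1 := (hp w).2 j hj
  have h2 := analyticAt_eval (pderiv i F) h1
  have h3 := fun n => analyticAt_apply_coord h1 n
  have h4 := fun n => analyticAt_apply_coord h1.deriv n
  have h5 : AnalyticAt ℂ (fun w => crossProduct (chart p j w) (deriv (chart p j) w) i) w := by
    have key : ∀ n k l o : Fin 3, AnalyticAt ℂ (fun w => chart p j w n * deriv (chart p j) w k -
        chart p j w l * deriv (chart p j) w o) w := fun n k l o =>
      ((h3 n).mul (h4 k)).sub ((h3 l).mul (h4 o))
    fin_cases i <;> exact key _ _ _ _
  exact ((h5.div h2 hi).mul (h3 a)).mul ((h3 b).pow d)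

/-- Entire curves of bounded speed in smooth plane curves of degree at least four are constant. -/
theorem isProjConst_of_smooth_of_speed_le (hF : F.IsHomogeneous (d + 4))
    (hs : ∀ x, x ≠ 0 → eval x F = 0 → ∃ i, eval x (pderiv i F) ≠ 0)
    (hp : IsProjCurve p) (h0 : ∀ w, eval (p w) F = 0) {M : ℝ} (hM : ∀ w, speed p w ≤ M) :
    IsProjConst p := by
  set J : ℂ → Fin 3 := fun w => topCoord (p w) with hJ
  have hJ0 : ∀ w, p w (J w) ≠ 0 := hp.apply_topCoord_ne_zero
  set grad : (Fin 3 → ℂ) → Fin 3 → ℂ := fun x i => eval x (pderiv i F) with hgrad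
  have hgradc : Continuous grad := continuous_pi fun i => MvPolynomial.continuous_eval _
  set I : ℂ → Fin 3 := fun w => topCoord (grad (chart p (J w) w)) with hI
  have hg0 : ∀ w j, p w j ≠ 0 → grad (chart p j w) ≠ 0 := fun w j hj =>
    Function.ne_iff.2 (hs _ (chart_ne_zero hj) (eval_chart_eq_zero hF h0 _ _))
  have hI0 : ∀ w, eval (chart p (J w) w) (pderiv (I w) F) ≠ 0 := by
    intro w h
    have h1 := norm_topCoord (grad (chart p (J w) w))
    have h2 : grad (chart p (J w) w) (I w) = 0 := h
    rw [h2, norm_zero] at h1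
    exact hg0 w _ (hJ0 w) (norm_eq_zero.1 h1.symm)
  obtain ⟨c, hc, hcg⟩ : ∃ c > 0, ∀ w, c ≤ ‖grad (chart p (J w) w)‖ := by
    set K : Set (Fin 3 → ℂ) := Metric.sphere 0 1 ∩ {x | eval x F = 0} with hK
    have hKc : IsCompact K := (isCompact_sphere _ _).inter_right
      (isClosed_singleton.preimage (MvPolynomial.continuous_eval F))
    have hmem : ∀ w, chart p (J w) w ∈ K := fun w =>
      ⟨by simpa using hp.norm_chart_topCoord w, eval_chart_eq_zero hF h0 _ _⟩
    obtain ⟨x, hx, hmin⟩ := hKc.exists_isMinOn ⟨_, hmem 0⟩ hgradc.norm.continuousOn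
    refine ⟨‖grad x‖, norm_pos_iff.2 (Function.ne_iff.2 (hs x ?_ hx.2)), fun w => hmin (hmem w)⟩
    rintro rfl
    simpa using hx.1
  set G : Fin 3 → Fin 3 → ℂ → ℂ := fun a b w => residueForm F d p (I w) (J w) a b w with hG
  have hGd : ∀ a b, Differentiable ℂ (G a b) := by
    intro a b w
    refine ((residueForm_analyticAt (d := d) hp (hJ0 w) (hI0 w) a b).congr
      ?_).differentiableAt
    have h1 := (analyticAt_eval (pderiv (I w) F) ((hp w).2 (J w) (hJ0 w))).continuousAt
      |>.eventually_ne (hI0 w)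
    filter_upwards [hp.eventually_ne_zero (hJ0 w), h1] with z hz hz'
    exact residueForm_eq hF hp h0 hz (hJ0 z) hz' (hI0 z) a b
  have hGb : ∀ a b w, ‖G a b w‖ ≤ 2 * M / c := by
    intro a b w
    have h1 : ‖chart p (J w) w‖ = 1 := hp.norm_chart_topCoord w
    have h2 : ‖deriv (chart p (J w)) w‖ ≤ M := hM w
    have h3 : c ≤ ‖eval (chart p (J w) w) (pderiv (I w) F)‖ :=
      (hcg w).trans_eq (norm_topCoord _).symm
    have h4 := norm_cross_le (chart p (J w) w) (deriv (chart p (J w)) w) (I w)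
    rw [h1] at h4
    have h5 : ∀ n, ‖chart p (J w) w n‖ ≤ 1 := fun n => h1 ▸ norm_le_pi_norm _ n
    have hM0 : 0 ≤ M := (norm_nonneg _).trans h2
    simp only [hG, residueForm, norm_mul, norm_div, norm_pow]
    calc _ ≤ 2 * M / c * 1 * 1 ^ d := by
          gcongr
          · linarith
          · exact h5 a
          · exact h5 b
      _ = 2 * M / c := by simp
  have hGc : ∀ a b w, G a b w = G a b 0 := fun a b w =>
    (hGd a b).apply_eq_apply_of_bounded
      (isBounded_iff_forall_norm_le.2 ⟨2 * M / c, by rintro _ ⟨w, rfl⟩; exact hGb a b w⟩) w 0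
  by_cases hz : ∀ a b, G a b 0 = 0
  · refine hp.isProjConst_of_speed_eq_zero fun w => ?_
    have h1 : chart p (J w) w (J w) = 1 := chart_apply_self (hJ0 w)
    have h2 := (hGc (J w) (J w) w).trans (hz _ _)
    simp only [hG, residueForm, h1, mul_one, one_pow, div_eq_zero_iff, hI0 w, or_false] at h2
    have h3 : ∀ i, crossProduct (chart p (J w) w) (deriv (chart p (J w)) w) i = 0 := by
      intro i
      have h4 := cross_mul_eq_cross_mul
        (sum_pderiv_mul_eq_zero hF (eval_chart_eq_zero hF h0 (J w) w))
        (sum_pderiv_mul_deriv_eq_zero hF hp h0 (hJ0 w)) i (I w)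
      rw [h2, zero_mul] at h4
      exact (mul_eq_zero.1 h4).resolve_right (hI0 w)
    have h5 : deriv (chart p (J w)) w (J w) = 0 := by
      have h6 := hasDerivAt_pi.1 ((hp w).2 _ (hJ0 w)).differentiableAt.hasDerivAt (J w)
      have h7 : (fun z => chart p (J w) z (J w)) =ᶠ[𝓝 w] fun _ => 1 :=
        (hp.eventually_ne_zero (hJ0 w)).mono fun z hz => chart_apply_self hz
      exact h6.unique ((hasDerivAt_const w 1).congr_of_eventuallyEq h7)
    have h8 : deriv (chart p (J w)) w = 0 := by
      generalize deriv (chart p (J w)) w = v at *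
      generalize chart p (J w) w = u at *
      generalize J w = j at *
      have e0 := h3 0
      have e1 := h3 1
      have e2 := h3 2
      simp only [cross_apply, Matrix.cons_val_zero, Matrix.cons_val_one,
        Matrix.cons_val] at e0 e1 e2
      funext i
      fin_cases j <;> fin_cases i <;> simp at * <;> grind
    rw [speed, h8, norm_zero]
  · push Not at hz
    obtain ⟨a₀, b, hab⟩ := hz
    have key : ∀ w, ∃ c : ℂ, c ≠ 0 ∧ (fun a => G a b 0) = c • p w := by
      intro w
      have h1 := hGc a₀ b w
      refine ⟨crossProduct (chart p (J w) w) (deriv (chart p (J w)) w) (I w) /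
        eval (chart p (J w) w) (pderiv (I w) F) * (p w (J w))⁻¹ * chart p (J w) w b ^ d, ?_, ?_⟩
      · intro h2
        rw [← h1] at hab
        refine hab ?_
        calc _ = (_ * _ * _) * p w a₀ := ?_
          _ = 0 := by rw [h2, zero_mul]
        simp only [hG, residueForm, chart, Pi.smul_apply, smul_eq_mul]
        ring
      · funext a
        rw [← hGc a b w]
        simp only [hG, residueForm, chart, Pi.smul_apply, smul_eq_mul]
        ring
    intro w w'
    obtain ⟨c₁, hc₁, h1⟩ := key w
    obtain ⟨c₂, hc₂, h2⟩ := key w'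
    exact ⟨c₂⁻¹ * c₁, by rw [mul_smul, ← h1, h2, smul_smul, inv_mul_cancel₀ hc₂, one_smul]⟩

/-- Entire curves in smooth plane curves of degree at least four are constant. -/
theorem isProjConst_of_smooth (hF : F.IsHomogeneous (d + 4))
    (hs : ∀ x, x ≠ 0 → eval x F = 0 → ∃ i, eval x (pderiv i F) ≠ 0)
    (hp : IsProjCurve p) (h0 : ∀ w, eval (p w) F = 0) : IsProjConst p := by
  by_contra hn
  obtain ⟨l, g, q, hl, -, hg, hgp, hlim, hq, hqn, hqs⟩ :=
    exists_brody_limit (h := fun _ => p) (fun _ => hp) fun _ => hn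
  refine hqn (isProjConst_of_smooth_of_speed_le hF hs hq (hlim.eval_eq_zero hF fun k z => ?_) hqs)
  obtain ⟨w, hw⟩ := hgp k z
  rw [hw, h0]

end PlaneCurve

end EntireCurve

namespace EntireCurve

/-- A nowhere vanishing entire function has an entire `n`-th root. -/
theorem exists_pow_eq_of_ne_zero {φ : ℂ → ℂ} (hφ : Differentiable ℂ φ) (h0 : ∀ w, φ w ≠ 0)
    {n : ℕ} (hn : n ≠ 0) : ∃ α : ℂ → ℂ, Differentiable ℂ α ∧ ∀ w, α w ^ n = φ w := by
  have hd : Differentiable ℂ fun w => deriv φ w / φ w := fun w =>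
    ((hφ.analyticAt w).deriv.div (hφ.analyticAt w) (h0 w)).differentiableAt
  obtain ⟨L, hL⟩ := hd.isExactOn_univ
  have hL' : ∀ w, HasDerivAt L (deriv φ w / φ w) w := fun w => hL w (Set.mem_univ w)
  obtain ⟨ζ, hζ⟩ := IsAlgClosed.exists_pow_nat_eq (φ 0 * Complex.exp (-L 0))
    (Nat.pos_of_ne_zero hn)
  have hn' : (n : ℂ) ≠ 0 := by exact_mod_cast hn
  have hLd : Differentiable ℂ L := fun w => (hL' w).differentiableAt
  refine ⟨fun w => ζ * Complex.exp (L w / n), by fun_prop, fun w => ?_⟩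
  have hder : ∀ w, HasDerivAt (fun w => φ w * Complex.exp (-L w)) 0 w := fun w => by
    have h1 := (hφ w).hasDerivAt.fun_mul (hL' w).fun_neg.cexp
    refine h1.congr_deriv ?_
    have := h0 w
    field_simp
    ring
  have hconst : φ w * Complex.exp (-L w) = φ 0 * Complex.exp (-L 0) :=
    is_const_of_deriv_eq_zero (fun w => (hder w).differentiableAt) (fun w => (hder w).deriv) w 0
  rw [mul_pow, hζ, ← hconst, ← Complex.exp_nat_mul, mul_div_cancel₀ _ hn', mul_assoc,
    ← Complex.exp_add, neg_add_cancel, Complex.exp_zero, mul_one]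

/-- Picard's little theorem. -/
theorem eq_of_ne_zero_of_ne_one {φ : ℂ → ℂ} (hφ : Differentiable ℂ φ) (h0 : ∀ w, φ w ≠ 0)
    (h1 : ∀ w, φ w ≠ 1) (w w' : ℂ) : φ w = φ w' := by
  obtain ⟨α, hα, hαφ⟩ := exists_pow_eq_of_ne_zero hφ h0 (n := 4) (by norm_num)
  obtain ⟨β, hβ, hβφ⟩ := exists_pow_eq_of_ne_zero (φ := fun w => 1 - φ w) (by fun_prop)
    (fun w => sub_ne_zero.2 (h1 w).symm) (n := 4) (by norm_num)
  obtain ⟨ζ, hζ⟩ := IsAlgClosed.exists_pow_nat_eq (-1 : ℂ) (n := 4) (by norm_num)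
  have hζ0 : ζ ≠ 0 := by rintro rfl; norm_num at hζ
  set F : MvPolynomial (Fin 3) ℂ := X 0 ^ 4 + X 1 ^ 4 + X 2 ^ 4 with hF
  have hFh : F.IsHomogeneous (0 + 4) :=
    ((isHomogeneous_X_pow _ _).add (isHomogeneous_X_pow _ _)).add (isHomogeneous_X_pow _ _)
  have hp : IsProjCurve fun w => ![α w, β w, ζ] := by
    refine isProjCurve_of_differentiable (differentiable_pi.2 fun i => ?_) fun w h => hζ0 ?_
    · fin_cases i
      exacts [hα, hβ, differentiable_const _]
    · simpa using congrFun h 2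
  have hconst := isProjConst_of_smooth hFh (fun x hx _ => ?_) hp fun w => ?_
  · obtain ⟨c, hc⟩ := hconst w' w
    have h2 : ζ = c * ζ := by simpa using congrFun hc 2
    have h3 : α w = c * α w' := by simpa using congrFun hc 0
    have h4 : c = 1 := by
      have : (c - 1) * ζ = 0 := by linear_combination -h2
      exact sub_eq_zero.1 ((mul_eq_zero.1 this).resolve_right hζ0)
    rw [← hαφ, ← hαφ, h3, h4, one_mul]
  · obtain ⟨i, hi⟩ := Function.ne_iff.1 hx
    refine ⟨i, ?_⟩
    fin_cases i <;> simpa [hF, pderiv_X, Pi.single_apply] using hi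
  · simp [hF, hαφ, hβφ, hζ]

/-- Dividing out common zeros: the composition of a projective curve with a coordinate
projection extends to a projective curve. -/
theorem IsProjCurve.exists_coord_projection {ι κ : Type*} [Fintype ι] [Fintype κ]
    {p : ℂ → ι → ℂ} (hp : IsProjCurve p) (e : κ → ι) {w₀ : ℂ} {i : κ} (hi : p w₀ (e i) ≠ 0) :
    ∃ q : ℂ → κ → ℂ, IsProjCurve q ∧ (∀ w, p w ∘ e ≠ 0 → q w = p w ∘ e) ∧
      ∀ w, ∀ᶠ z in 𝓝[≠] w, p z ∘ e ≠ 0 := by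
  have hne : ∀ w, ∀ᶠ z in 𝓝[≠] w, p z ∘ e ≠ 0 := by
    intro w
    have h1 := (hp.eval_eq_zero_or (isHomogeneous_X ℂ (e i))).resolve_left
      fun h => hi (by simpa using h w₀)
    filter_upwards [h1 w] with z hz h2
    exact hz (by simpa using congrFun h2 i)
  have key : ∀ w, ∃ (H : ℂ → κ → ℂ) (j : ι) (n : ℕ), p w j ≠ 0 ∧ AnalyticAt ℂ H w ∧ H w ≠ 0 ∧
      ∀ᶠ z in 𝓝 w, chart p j z ∘ e = (z - w) ^ n • H z := by
    intro w
    obtain ⟨j, hj⟩ := hp.exists_ne_zero w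
    have h1 : AnalyticAt ℂ (fun z => chart p j z ∘ e) w :=
      analyticAt_pi_iff.2 fun k => analyticAt_apply_coord ((hp w).2 j hj) (e k)
    obtain ⟨n, H, hH, hH0, hev⟩ := h1.exists_eventuallyEq_pow_smul_nonzero_iff.2 fun h2 => by
      obtain ⟨z, h3, h4, h5⟩ := ((h2.filter_mono nhdsWithin_le_nhds).and ((hne w).and
        ((hp.eventually_ne_zero hj).filter_mono nhdsWithin_le_nhds))).exists
      exact h4 (by rw [eq_smul_chart h5, Pi.smul_comp, h3, smul_zero])
    exact ⟨H, j, n, hj, hH, hH0, hev⟩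
  choose H j n hj hH hH0 hev using key
  classical
  refine ⟨fun w => if p w ∘ e = 0 then H w w else p w ∘ e, isProjCurve_of_lift fun w =>
    ⟨H w, hH w, hH0 w, ?_⟩, fun w hw => if_neg hw, hne⟩
  filter_upwards [hev w, hp.eventually_ne_zero (hj w), eventually_nhdsWithin_iff.1 (hne w)]
    with z h1 h2 h3
  have h4 : p z ∘ e = (p z (j w) * (z - w) ^ n w) • H w z := by
    rw [mul_smul, ← h1, ← Pi.smul_comp, ← eq_smul_chart h2]
  by_cases h5 : p z ∘ e = 0
  · have : z = w := by
      by_contra h6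
      exact h3 h6 h5
    subst this
    exact ⟨1, one_ne_zero, by simp [h5]⟩
  · exact ⟨p z (j w) * (z - w) ^ n w, fun h6 => h5 (by rw [h4, h6, zero_smul]),
      by rw [if_neg h5, h4]⟩

/-- If a coordinate projection of a projective curve lies on a smooth plane curve of degree at
least four, then it is contained in a line through the origin. -/
theorem IsProjCurve.exists_eq_smul_of_smooth {ι : Type*} [Fintype ι] {p : ℂ → ι → ℂ}
    (hp : IsProjCurve p) (e : Fin 3 → ι) {F : MvPolynomial (Fin 3) ℂ} {d : ℕ}
    (hF : F.IsHomogeneous (d + 4))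
    (hs : ∀ x, x ≠ 0 → eval x F = 0 → ∃ i, eval x (pderiv i F) ≠ 0)
    (h0 : ∀ w, eval (p w ∘ e) F = 0) {w₀ : ℂ} {i : Fin 3} (hi : p w₀ (e i) ≠ 0) :
    ∃ c : Fin 3 → ℂ, c ≠ 0 ∧ eval c F = 0 ∧ ∀ w, ∃ μ : ℂ, p w ∘ e = μ • c := by
  obtain ⟨q, hq, hqp, hne⟩ := hp.exists_coord_projection e hi
  have hq0 : ∀ w, eval (q w) F = 0 := by
    refine (hq.eval_eq_zero_or hF).resolve_right fun h => ?_
    obtain ⟨z, h1, h2⟩ := ((h 0).and (hne 0)).exists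
    exact h1 (by rw [hqp z h2, h0])
  have hc := isProjConst_of_smooth hF hs hq hq0
  refine ⟨q 0, (hq 0).1, hq0 0, fun w => ?_⟩
  by_cases h1 : p w ∘ e = 0
  · exact ⟨0, by rw [h1, zero_smul]⟩
  · rw [← hqp w h1]
    exact hc 0 w

end EntireCurve

namespace EntireCurve

section Trinomial

/-- The trinomial `x ^ m - a * x + τ` as a polynomial has degree `m`. -/
theorem natDegree_trinomial {m : ℕ} (hm : 4 ≤ m) (a τ : ℂ) :
    (Polynomial.X ^ m - Polynomial.C a * Polynomial.X + Polynomial.C τ).natDegree = m := by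
  rw [Polynomial.natDegree_add_C, Polynomial.natDegree_sub_eq_left_of_natDegree_lt,
    Polynomial.natDegree_X_pow]
  rw [Polynomial.natDegree_X_pow]
  exact ((Polynomial.natDegree_C_mul_le a _).trans Polynomial.natDegree_X_le).trans_lt (by omega)

/-- The trinomial `x ^ m - a * x + τ` has three distinct roots different from the negative of a
given root. -/
theorem exists_three_roots {m : ℕ} (hm : 4 ≤ m) {a τ c : ℂ} (h : ¬ (a = 0 ∧ τ = 0))
    (hc : c ^ m - a * c + τ = 0) : ∃ S : Finset ℂ, 2 < S.card ∧
      ∀ x ∈ S, x ^ m - a * x + τ = 0 ∧ x ≠ -c := by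
  classical
  set P : Polynomial ℂ := Polynomial.X ^ m - Polynomial.C a * Polynomial.X + Polynomial.C τ with hP
  have hdeg : P.natDegree = m := natDegree_trinomial hm a τ
  have hP0 : P ≠ 0 := by
    intro h0
    rw [h0, Polynomial.natDegree_zero] at hdeg
    omega
  have hroot : ∀ x, P.IsRoot x ↔ x ^ m - a * x + τ = 0 := fun x => by simp [hP]
  have hm0 : (m : ℂ) ≠ 0 := by exact_mod_cast (by omega : m ≠ 0)
  have hm1 : ((m - 1 : ℕ) : ℂ) ≠ 0 := by exact_mod_cast (by omega : m - 1 ≠ 0)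
  have hcast : ((m - 1 : ℕ) : ℂ) = m - 1 := by push_cast [show 1 ≤ m by omega]; ring
  have hder : ∀ x, P.derivative.IsRoot x ↔ m * x ^ (m - 1) - a = 0 := fun x => by
    simp [hP, Polynomial.derivative_X_pow]
  have hdouble : ∀ x, 1 < P.rootMultiplicity x → m * x ^ (m - 1) = a ∧ a ≠ 0 ∧
      a * x * (m - 1 : ℕ) = m * τ := by
    intro x hx
    obtain ⟨h1, h2⟩ := (Polynomial.one_lt_rootMultiplicity_iff_isRoot hP0).1 hx
    rw [hroot] at h1
    rw [hder, sub_eq_zero] at h2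
    have h3 : x ^ m = x ^ (m - 1) * x := by rw [← pow_succ, Nat.sub_add_cancel (by omega)]
    have h4 : a * x * (m - 1 : ℕ) = m * τ := by
      rw [hcast]
      rw [h3] at h1
      linear_combination (-(m : ℂ)) * h1 + x * h2
    refine ⟨h2, fun ha => h ⟨ha, ?_⟩, h4⟩
    rw [ha, zero_mul, zero_mul] at h4
    exact (mul_eq_zero.1 h4.symm).resolve_left hm0
  have htriple : ∀ x, P.rootMultiplicity x ≤ 2 := by
    intro x
    by_contra! hx
    obtain ⟨h1, h2, -⟩ := hdouble x (by omega)
    have hr : P.IsRoot x := (Polynomial.rootMultiplicity_pos hP0).1 (by omega)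
    have h3 := Polynomial.derivative_rootMultiplicity_of_root hr
    have hd0 : P.derivative ≠ 0 := fun h0 => by
      rw [h0, Polynomial.rootMultiplicity_zero] at h3
      omega
    have h4 := ((Polynomial.one_lt_rootMultiplicity_iff_isRoot (t := x) hd0).1 (by omega)).2
    have h5 : P.derivative.derivative.eval x = m * ((m - 1 : ℕ) * x ^ (m - 1 - 1)) := by
      simp [hP, Polynomial.derivative_X_pow]
    rw [Polynomial.IsRoot, h5] at h4
    have h6 : x = 0 := by simpa [hm0, hm1, show m - 1 - 1 ≠ 0 by omega] using h4
    rw [h6, zero_pow (by omega), mul_zero] at h1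
    exact h2 h1.symm
  set R := P.roots.toFinset with hR
  have hsum : ∑ x ∈ R, P.rootMultiplicity x = m := by
    simp_rw [← Polynomial.count_roots]
    rw [hR, Multiset.toFinset_sum_count_eq, IsAlgClosed.card_roots_eq_natDegree, hdeg]
  set D := R.filter fun x => 1 < P.rootMultiplicity x with hD
  have hDcard : D.card ≤ 1 := by
    refine Finset.card_le_one.2 fun x hx y hy => ?_
    obtain ⟨-, h1, h2⟩ := hdouble x (Finset.mem_filter.1 hx).2
    obtain ⟨-, -, h3⟩ := hdouble y (Finset.mem_filter.1 hy).2
    exact mul_left_cancel₀ h1 (mul_right_cancel₀ hm1 (h2.trans h3.symm))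
  have hle : m ≤ R.card + D.card := by
    rw [← hsum, hD, Finset.card_filter, Finset.card_eq_sum_ones, ← Finset.sum_add_distrib]
    refine Finset.sum_le_sum fun x _ => ?_
    have := htriple x
    split_ifs <;> omega
  have hmem : ∀ x ∈ R, x ^ m - a * x + τ = 0 := fun x hx =>
    (hroot x).1 (Polynomial.isRoot_of_mem_roots (Multiset.mem_toFinset.1 hx))
  refine ⟨R.erase (-c), ?_, fun x hx =>
    ⟨hmem x (Finset.mem_of_mem_erase hx), Finset.ne_of_mem_erase hx⟩⟩
  have hcard := Finset.pred_card_le_card_erase (s := R) (a := -c)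
  rcases hm.eq_or_lt with rfl | hm5
  · by_cases hcR : -c ∈ R
    · have hac : a * c = 0 := by
        have := hmem _ hcR
        rw [Even.neg_pow (by decide)] at this
        linear_combination (this - hc) / 2
      have hD0 : D = ∅ := by
        refine Finset.eq_empty_of_forall_notMem fun x hx => ?_
        obtain ⟨h1, h2, h3⟩ := hdouble x (Finset.mem_filter.1 hx).2
        have hc0 : c = 0 := (mul_eq_zero.1 hac).resolve_left h2
        have hτ : τ = 0 := by simpa [hc0] using hc
        rw [hτ, mul_zero] at h3
        have hx0 : x = 0 := by simpa [h2, hm1] using h3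
        rw [hx0] at h1
        exact h2 (by simpa using h1.symm)
      rw [hD0, Finset.card_empty] at hle
      omega
    · rw [Finset.erase_eq_of_notMem hcR]
      omega
  · omega

/-- The trinomial has finitely many roots. -/
theorem finite_roots {m : ℕ} (hm : 4 ≤ m) (a τ : ℂ) : {x : ℂ | x ^ m - a * x + τ = 0}.Finite := by
  set P : Polynomial ℂ := Polynomial.X ^ m - Polynomial.C a * Polynomial.X + Polynomial.C τ with hP
  have hdeg : P.natDegree = m := natDegree_trinomial hm a τ
  have hP0 : P ≠ 0 := by
    intro h0
    rw [h0, Polynomial.natDegree_zero] at hdeg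
    omega
  refine (Polynomial.finite_setOfPred_isRoot hP0).subset fun x hx => ?_
  simpa [hP] using hx

end Trinomial

end EntireCurve

namespace EntireCurve

section PlaneTrinomial

variable {m : ℕ}

/-- A smooth plane curve of degree `m`, monic in the first variable. -/
noncomputable def trinomial (m : ℕ) : MvPolynomial (Fin 3) ℂ :=
  X 0 ^ m - C (m : ℂ) * X 0 * X 1 ^ (m - 1) + X 2 ^ m

theorem eval_trinomial (x : Fin 3 → ℂ) :
    eval x (trinomial m) = x 0 ^ m - m * x 0 * x 1 ^ (m - 1) + x 2 ^ m := by simp [trinomial]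

theorem trinomial_isHomogeneous (hm : 4 ≤ m) : (trinomial m).IsHomogeneous m := by
  have h : (C (m : ℂ) * X 0 * X 1 ^ (m - 1) : MvPolynomial (Fin 3) ℂ).IsHomogeneous m := by
    have := ((isHomogeneous_C (Fin 3) (m : ℂ)).mul (isHomogeneous_X ℂ (0 : Fin 3))).mul
      ((isHomogeneous_X ℂ (1 : Fin 3)).pow (m - 1))
    convert this using 1
    omega
  have hX (i : Fin 3) : (X i ^ m : MvPolynomial (Fin 3) ℂ).IsHomogeneous m := by
    simpa using (isHomogeneous_X ℂ i).pow m
  exact ((hX 0).sub h).add (hX 2)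

theorem trinomial_smooth (hm : 4 ≤ m) (x : Fin 3 → ℂ) (hx : x ≠ 0) :
    ∃ i, eval x (pderiv i (trinomial m)) ≠ 0 := by
  by_contra! h
  have h0 := h 0
  have h1 := h 1
  have h2 := h 2
  have hm0 : (m : ℂ) ≠ 0 := by exact_mod_cast (by omega : m ≠ 0)
  have e1 : m - 1 ≠ 0 := by omega
  simp only [trinomial] at h0 h1 h2
  simp [pderiv_X, Derivation.leibniz, Derivation.leibniz_pow] at h0 h1 h2
  have hm' : m ≠ 0 := by omega
  have h01 : x 0 ^ (m - 1) = x 1 ^ (m - 1) :=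
    mul_left_cancel₀ hm0 (by linear_combination h0)
  have hx2 : x 2 = 0 := (h2.resolve_left hm').1
  have hx01 : x 0 = 0 ∧ x 1 = 0 := by
    rcases h1 with (h1 | h1) | h1 | h1
    · exact absurd h1 hm'
    · exact ⟨h1, by simpa [h1, e1] using h01.symm⟩
    · exact absurd h1 e1
    · exact ⟨by simpa [h1.1, e1] using h01, h1.1⟩
  refine hx (funext fun i => ?_)
  fin_cases i
  exacts [hx01.1, hx01.2, hx2]

end PlaneTrinomial

variable {ι : Type*} [Fintype ι]

theorem IsProjCurve.differentiable_div {p : ℂ → ι → ℂ} (hp : IsProjCurve p)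
    {P Q : MvPolynomial ι ℂ} {d : ℕ} (hP : P.IsHomogeneous d) (hQ : Q.IsHomogeneous d)
    (hne : ∀ w, eval (p w) Q ≠ 0) : Differentiable ℂ fun w => eval (p w) P / eval (p w) Q := by
  intro w
  obtain ⟨j, hj⟩ := hp.exists_ne_zero w
  have h := hp.eventually_ne_zero hj
  have hc : ∀ z, p z j ≠ 0 → ∀ {R : MvPolynomial ι ℂ}, R.IsHomogeneous d →
      eval (p z) R = p z j ^ d * eval (chart p j z) R := fun z hz R hR => by
    rw [← eval_smul_of_isHomogeneous hR, ← eq_smul_chart hz]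
  have ha := (hp w).2 j hj
  have hQw : eval (chart p j w) Q ≠ 0 := fun h0 => hne w (by rw [hc w hj hQ, h0, mul_zero])
  refine (((analyticAt_eval P ha).div (analyticAt_eval Q ha) hQw).congr ?_).differentiableAt
  filter_upwards [h] with z hz
  simp only [Pi.div_apply]
  rw [hc z hz hP, hc z hz hQ, mul_div_mul_left _ _ (pow_ne_zero d hz)]

/-- An entire curve on the cone over the plane curve, which meets a second such cone only where it
is locally contained in it, is constant. -/
theorem isProjConst_of_trinomial {m : ℕ} (hm : 4 ≤ m) {p : ℂ → Fin 4 → ℂ} (hp : IsProjCurve p)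
    {A B : Fin 4} (hAB : ∀ i, i = 0 ∨ i = 1 ∨ i = A ∨ i = B)
    (hA : ∀ w, eval (p w ∘ ![A, 0, 1]) (trinomial m) = 0)
    (hB : ∀ w, eval (p w ∘ ![B, 0, 1]) (trinomial m) = 0 → p w A + p w B ≠ 0 →
      ∀ᶠ z in 𝓝 w, eval (p z ∘ ![B, 0, 1]) (trinomial m) = 0) : IsProjConst p := by
  have hprop : ∀ {s : ℂ → ℂ} {v : Fin 4 → ℂ}, (∀ w i, p w i = s w * v i) → IsProjConst p := by
    intro s v h w w'
    have hs : s w ≠ 0 := fun h0 => (hp w).1 (funext fun i => by simp [h, h0])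
    refine ⟨s w' / s w, funext fun i => ?_⟩
    rw [Pi.smul_apply, smul_eq_mul, h, h]
    field_simp
  by_cases hz : ∀ w i, p w (![A, 0, 1] i) = 0
  · refine hprop (s := fun w => p w B) (v := fun i => if i = B then 1 else 0) fun w i => ?_
    by_cases hi : i = B
    · simp [hi]
    · rw [if_neg hi, mul_zero]
      rcases hAB i with h | h | h | h
      · rw [h]; exact hz w 1
      · rw [h]; exact hz w 2
      · rw [h]; exact hz w 0
      · exact absurd h hi
  push Not at hz
  obtain ⟨w₀, i₀, hi₀⟩ := hz
  obtain ⟨d, rfl⟩ := Nat.exists_eq_add_of_le' hm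
  obtain ⟨c, hc0, hc, hμ⟩ := hp.exists_eq_smul_of_smooth ![A, 0, 1] (trinomial_isHomogeneous hm)
    (fun x hx _ => trinomial_smooth hm x hx) hA hi₀
  choose μ hμ using hμ
  obtain ⟨j, hj⟩ := Function.ne_iff.1 hc0
  rw [Pi.zero_apply] at hj
  generalize hm' : d + 4 = m at *
  have hμj : ∀ w, μ w = p w (![A, 0, 1] j) / c j := fun w => by
    rw [eq_div_iff hj]
    exact (congrFun (hμ w) j).symm
  have hpA : ∀ w, p w A = μ w * c 0 := fun w => congrFun (hμ w) 0
  have hp0 : ∀ w, p w 0 = μ w * c 1 := fun w => congrFun (hμ w) 1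
  have hp1 : ∀ w, p w 1 = μ w * c 2 := fun w => congrFun (hμ w) 2
  have hlin : ∀ {s : ℂ → ℂ} {κ ν : ℂ}, (∀ w, μ w = κ * s w) → (∀ w, p w B = ν * s w) →
      IsProjConst p := by
    intro s κ ν h1 h2
    refine hprop (s := s) (v := fun i => if i = B then ν else if i = A then κ * c 0 else
      if i = 0 then κ * c 1 else κ * c 2) fun w i => ?_
    by_cases hiB : i = B
    · simp [hiB, h2, mul_comm]
    by_cases hiA : i = A
    · rw [if_neg hiB, if_pos hiA, hiA, hpA, h1]; ring
    by_cases hi0 : i = 0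
    · rw [if_neg hiB, if_neg hiA, if_pos hi0, hi0, hp0, h1]; ring
    have hi1 : i = 1 := by
      rcases hAB i with h | h | h | h
      exacts [absurd h hi0, h, absurd h hiA, absurd h hiB]
    rw [if_neg hiB, if_neg hiA, if_neg hi0, hi1, hp1, h1]; ring
  set a : ℂ := m * c 1 ^ (m - 1) with ha
  set τ : ℂ := c 2 ^ m with hτ
  have hpow : ∀ y : ℂ, y ^ m = y ^ (m - 1) * y := fun y => by
    rw [← pow_succ, Nat.sub_add_cancel (by omega)]
  have hF : ∀ w x, p w B = x * μ w →
      eval (p w ∘ ![B, 0, 1]) (trinomial m) = μ w ^ m * (x ^ m - a * x + τ) := by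
    intro w x hx
    rw [eval_trinomial]
    simp only [Function.comp, Matrix.cons_val_zero, Matrix.cons_val_one, Matrix.cons_val, hx, hp0,
      hp1, mul_pow, ha, hτ]
    rw [hpow (μ w)]
    ring
  have hcr : c 0 ^ m - a * c 0 + τ = 0 := by
    rw [eval_trinomial] at hc
    linear_combination hc
  have haτ : ¬ (a = 0 ∧ τ = 0) := by
    rintro ⟨h1, h2⟩
    have hm0 : (m : ℂ) ≠ 0 := by exact_mod_cast (by omega : m ≠ 0)
    have h3 : c 1 = 0 := by
      simpa [ha, hm0, show m - 1 ≠ 0 by omega] using h1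
    have h4 : c 2 = 0 := by simpa [hτ, show m ≠ 0 by omega] using h2
    have h5 : c 0 = 0 := by
      rw [h1, h2] at hcr
      simpa [show m ≠ 0 by omega] using hcr
    refine hc0 (funext fun i => ?_)
    fin_cases i
    exacts [h5, h3, h4]
  by_contra hn
  let L (x : ℂ) : MvPolynomial (Fin 4) ℂ := X B - C (x / c j) * X (![A, 0, 1] j)
  have hLhom : ∀ x, (L x).IsHomogeneous 1 := fun x => by
    refine (isHomogeneous_X ℂ B).sub ?_
    simpa using (isHomogeneous_C (Fin 4) (x / c j)).mul (isHomogeneous_X ℂ (![A, 0, 1] j))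
  have hL : ∀ x w, eval (p w) (L x) = p w B - x * μ w := fun x w => by
    simp [L, hμj]
    ring
  have hvan : ∀ x, x ^ m - a * x + τ = 0 → x ≠ -c 0 → ∀ w, eval (p w) (L x) ≠ 0 := by
    intro x hx hxc w hw
    rw [hL, sub_eq_zero] at hw
    have hμ0 : μ w ≠ 0 := fun h0 => (hp w).1 <| funext fun i => by
      rcases hAB i with h | h | h | h <;> simp [h, hp0, hp1, hpA, hw, h0]
    have hne : p w A + p w B ≠ 0 := by
      rw [hpA, hw, show μ w * c 0 + x * μ w = μ w * (x - -c 0) by ring]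
      exact mul_ne_zero hμ0 (sub_ne_zero.2 hxc)
    have hev := hB w (by rw [hF w x hw, hx, mul_zero]) hne
    have hnz : ∀ y, ∀ᶠ z in 𝓝[≠] w, eval (p z) (L y) ≠ 0 := fun y => by
      refine ((hp.eval_eq_zero_or (hLhom y)).resolve_left fun h => hn ?_) w
      exact hlin (s := μ) (κ := 1) (ν := y) (fun _ => (one_mul _).symm) fun z =>
        sub_eq_zero.1 ((hL y z).symm.trans (h z))
    have hall := (Filter.eventually_all_finite (finite_roots hm a τ)).2 fun y _ => hnz y
    have hμev : ∀ᶠ z in 𝓝 w, p z (![A, 0, 1] j) ≠ 0 := hp.eventually_ne_zero fun h0 =>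
      hμ0 (by rw [hμj, h0, zero_div])
    obtain ⟨z, ⟨hz1, hz2⟩, hz3⟩ :=
      ((hall.and (hev.filter_mono nhdsWithin_le_nhds)).and
        (hμev.filter_mono nhdsWithin_le_nhds)).exists
    have hμz : μ z ≠ 0 := by
      rw [hμj]
      exact div_ne_zero hz3 hj
    have hxz : p z B = p z B / μ z * μ z := (div_mul_cancel₀ _ hμz).symm
    rw [hF z _ hxz] at hz2
    refine hz1 (p z B / μ z) ((mul_eq_zero.1 hz2).resolve_left (pow_ne_zero m hμz)) ?_
    rw [hL, ← hxz, sub_self]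
  obtain ⟨S, hS, hSr⟩ := exists_three_roots hm haτ hcr
  obtain ⟨x₁, h1, x₂, h2, x₃, h3, h12, h13, h23⟩ := Finset.two_lt_card.1 hS
  have hv1 := hvan x₁ (hSr _ h1).1 (hSr _ h1).2
  have hv2 := hvan x₂ (hSr _ h2).1 (hSr _ h2).2
  have hv3 := hvan x₃ (hSr _ h3).1 (hSr _ h3).2
  have h13' := sub_ne_zero.2 h13.symm
  have h23' := sub_ne_zero.2 h23.symm
  have hpic := eq_of_ne_zero_of_ne_one
    ((hp.differentiable_div (hLhom x₁) (hLhom x₂) hv2).const_mul ((x₃ - x₂) / (x₃ - x₁)))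
    (fun w => mul_ne_zero (div_ne_zero h23' h13') (div_ne_zero (hv1 w) (hv2 w)))
    (fun w h => by
      have hv := hv2 w
      rw [div_mul_div_comm, div_eq_one_iff_eq (mul_ne_zero h13' hv), hL, hL] at h
      refine mul_ne_zero (sub_ne_zero.2 h12) (hv3 w) ?_
      rw [hL]
      linear_combination h)
  obtain ⟨K, hK⟩ : ∃ K : ℂ, ∀ w, eval (p w) (L x₁) = K * eval (p w) (L x₂) := by
    refine ⟨eval (p 0) (L x₁) / eval (p 0) (L x₂), fun w => ?_⟩
    have := mul_left_cancel₀ (div_ne_zero h23' h13') (hpic w 0)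
    rw [← this, div_mul_cancel₀ _ (hv2 w)]
  have h12' := sub_ne_zero.2 h12
  refine hn (hlin (s := fun w => eval (p w) (L x₂)) (κ := (1 - K) / (x₁ - x₂))
    (ν := 1 + x₂ * ((1 - K) / (x₁ - x₂))) (fun w => ?_) fun w => ?_)
  all_goals
    have h := hK w
    simp only [hL] at h ⊢
    field_simp
  · linear_combination -h
  · linear_combination -x₂ * h

end EntireCurve

namespace EntireCurve

section Deformation

variable {ι : Type*} [Fintype ι]

/-- A consequence of Hurwitz's theorem: a limit curve which meets a hypersurface avoided by the
approximating curves away from `U = 0` is locally contained in it. -/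
theorem ChartLimit.eventually_eval_eq_zero {l : Filter ℕ} [l.NeBot] {g : ℕ → ℂ → ι → ℂ}
    {p : ℂ → ι → ℂ} (h : ChartLimit l g p) (hg : ∀ k, IsProjCurve (g k))
    {Q U : MvPolynomial ι ℂ} {d e : ℕ} (hQ : Q.IsHomogeneous d) (hU : U.IsHomogeneous e)
    (hne : ∀ k z, eval (g k z) U ≠ 0 → eval (g k z) Q ≠ 0) {w : ℂ} (hw : eval (p w) Q = 0)
    (hUw : eval (p w) U ≠ 0) : ∀ᶠ z in 𝓝 w, eval (p z) Q = 0 := by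
  obtain ⟨j, r, hr, -, hgj, hlim⟩ := h w
  have hp := (hlim w (Metric.mem_ball_self hr)).1
  have hU0 : eval (chart p j w) U ≠ 0 := by
    rw [chart, eval_smul_of_isHomogeneous hU]
    exact mul_ne_zero (pow_ne_zero e (inv_ne_zero hp)) hUw
  have hUlim := ((continuous_eval U).continuousAt.tendsto.comp
    (hlim w (Metric.mem_ball_self hr)).2).eventually_ne hU0
  obtain ⟨a, ha, b, hb, hab⟩ := eventually_prod_iff.1 hUlim
  obtain ⟨s, hs, hsb⟩ := Metric.eventually_nhds_iff_ball.1 hb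
  have hsub : Metric.ball w (min r s) ⊆ Metric.ball w r := Metric.ball_subset_ball (min_le_left _ _)
  have hzero := eventually_eq_zero_of_tendstoLocallyUniformlyOn (l := l) (w := w) (r := min r s)
    (G := fun k z => eval (chart (g k) j z) Q) (f := fun z => eval (chart p j z) Q) (lt_min hr hs)
    ?_ ?_ ?_ ?_
  · filter_upwards [hzero, Metric.ball_mem_nhds w hr] with z hz hzr
    rw [eq_smul_chart (hlim z hzr).1, eval_smul_of_isHomogeneous hQ, hz, mul_zero]
  · filter_upwards [hgj] with k hk z hz
    have := analyticAt_eval Q ((hg k z).2 j (hk z (hsub hz)))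
    exact this.differentiableAt.differentiableWithinAt
  · filter_upwards [hgj, ha] with k hk hak z hz
    have h1 : eval (chart (g k) j z) U ≠ 0 :=
      hab hak (hsb z (Metric.ball_subset_ball (min_le_right _ _) hz))
    rw [chart, eval_smul_of_isHomogeneous hU] at h1
    rw [chart, eval_smul_of_isHomogeneous hQ]
    exact mul_ne_zero (pow_ne_zero d (inv_ne_zero (hk z (hsub hz))))
      (hne k z (mul_ne_zero_iff.1 h1).2)
  · exact tendstoLocallyUniformlyOn_of_tendsto_prod
      (F := fun k z => eval (chart (g k) j z) Q) (f := fun z => eval (chart p j z) Q) fun z hz =>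
      (continuous_eval Q).continuousAt.tendsto.comp (hlim z (hsub hz)).2
  · rw [chart, eval_smul_of_isHomogeneous hQ, hw, mul_zero]

theorem ChartLimit.eval_eq_zero_of_tendsto_zero {l : Filter ℕ} [l.NeBot] {g : ℕ → ℂ → ι → ℂ}
    {p : ℂ → ι → ℂ} (h : ChartLimit l g p) {Q U : MvPolynomial ι ℂ} {d : ℕ}
    (hQ : Q.IsHomogeneous d) (hU : U.IsHomogeneous d) {t : ℕ → ℂ} (ht : Tendsto t l (𝓝 0))
    (hg : ∀ k z, eval (g k z) Q + t k * eval (g k z) U = 0) (w : ℂ) : eval (p w) Q = 0 := by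
  obtain ⟨j, r, hr, -, -, hlim⟩ := h w
  obtain ⟨hj, hlim⟩ := hlim w (Metric.mem_ball_self hr)
  have hlim := tendsto_of_tendsto_prod (F := fun k => chart (g k) j) hlim
  have hQlim := (continuous_eval Q).continuousAt.tendsto.comp hlim
  have hUlim := (continuous_eval U).continuousAt.tendsto.comp hlim
  have hsum := hQlim.add (ht.mul hUlim)
  have hzero : ∀ k, eval (chart (g k) j w) Q + t k * eval (chart (g k) j w) U = 0 := fun k => by
    rw [chart, eval_smul_of_isHomogeneous hQ, eval_smul_of_isHomogeneous hU, mul_left_comm,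
      ← mul_add, hg, mul_zero]
  simp only [Function.comp_apply, hzero, zero_mul, add_zero] at hsum
  rw [eq_smul_chart hj, eval_smul_of_isHomogeneous hQ,
    ← tendsto_nhds_unique tendsto_const_nhds hsum, mul_zero]

/-- The cone over the plane curve `trinomial m` in the coordinates `j`, `0` and `1`. -/
noncomputable def coneTrinomial (m : ℕ) (j : Fin 4) : MvPolynomial (Fin 4) ℂ :=
  rename ![j, 0, 1] (trinomial m)

theorem coneTrinomial_isHomogeneous {m : ℕ} (hm : 4 ≤ m) (j : Fin 4) :
    (coneTrinomial m j).IsHomogeneous m := (trinomial_isHomogeneous hm).rename_isHomogeneous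

theorem eval_coneTrinomial (m : ℕ) (j : Fin 4) (x : Fin 4 → ℂ) :
    eval x (coneTrinomial m j) = eval (x ∘ ![j, 0, 1]) (trinomial m) := eval_rename _ _ _

theorem isHomogeneous_coneTrinomial_mul {m n : ℕ} (hm : 4 ≤ m) (hn : 2 ≤ n) :
    (coneTrinomial m 2 * coneTrinomial m 3 ^ (n - 1)).IsHomogeneous (m * n) := by
  convert (coneTrinomial_isHomogeneous hm 2).mul
    ((coneTrinomial_isHomogeneous hm 3).pow (n - 1)) using 1
  obtain ⟨k, rfl⟩ := Nat.exists_eq_add_of_le' hn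
  simp
  ring

theorem isHomogeneous_X_add_X_pow {σ : Type*} (i j : σ) (d : ℕ) :
    ((X i + X j) ^ d : MvPolynomial σ ℂ).IsHomogeneous d := by
  simpa using ((isHomogeneous_X ℂ i).add (isHomogeneous_X ℂ j)).pow d

/-- A limit of entire curves in the surfaces `r + t • (X 2 + X 3) ^ (m * n) = 0`, where `r` is the
union of two cones with multiplicities, is constant as `t` tends to zero. -/
theorem isProjConst_of_coneTrinomial_limit {m n : ℕ} (hm : 4 ≤ m) (hn : 2 ≤ n)
    {l : Filter ℕ} [l.NeBot]
    {g : ℕ → ℂ → Fin 4 → ℂ} {p : ℂ → Fin 4 → ℂ} (h : ChartLimit l g p)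
    (hg : ∀ k, IsProjCurve (g k)) {t : ℕ → ℂ} (ht : Tendsto t l (𝓝 0)) (ht0 : ∀ k, t k ≠ 0)
    (h0 : ∀ k z, eval (g k z) (coneTrinomial m 2 * coneTrinomial m 3 ^ (n - 1)) +
      t k * eval (g k z) ((X 2 + X 3) ^ (m * n)) = 0) : IsProjConst p := by
  have hp := h.isProjCurve hg
  have hne : ∀ k z, eval (g k z) ((X 2 + X 3) ^ (m * n)) ≠ 0 →
      eval (g k z) (coneTrinomial m 2) ≠ 0 ∧ eval (g k z) (coneTrinomial m 3) ≠ 0 := by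
    intro k z hz
    have h1 : eval (g k z) (coneTrinomial m 2 * coneTrinomial m 3 ^ (n - 1)) ≠ 0 := fun h1 =>
      mul_ne_zero (ht0 k) hz (by simpa [h1] using h0 k z)
    rw [map_mul, map_pow] at h1
    exact ⟨(mul_ne_zero_iff.1 h1).1, fun h2 => (mul_ne_zero_iff.1 h1).2 <| by
      rw [h2, zero_pow (by omega)]⟩
  have hhur : ∀ (A B : Fin 4) (w : ℂ), (∀ x : Fin 4 → ℂ, x 2 + x 3 = x A + x B) →
      (∀ k z, eval (g k z) ((X 2 + X 3) ^ (m * n)) ≠ 0 →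
        eval (g k z) (coneTrinomial m B) ≠ 0) →
      eval (p w ∘ ![B, 0, 1]) (trinomial m) = 0 → p w A + p w B ≠ 0 →
      ∀ᶠ z in 𝓝 w, eval (p z ∘ ![B, 0, 1]) (trinomial m) = 0 := by
    intro A B w hAB hB hw hne
    simp only [← eval_coneTrinomial] at hw ⊢
    refine h.eventually_eval_eq_zero hg (coneTrinomial_isHomogeneous hm B)
      (isHomogeneous_X_add_X_pow 2 3 _) hB hw ?_
    simpa [hAB] using fun h => absurd h hne
  have hzero := h.eval_eq_zero_of_tendsto_zero (isHomogeneous_coneTrinomial_mul hm hn)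
    (isHomogeneous_X_add_X_pow 2 3 _) ht h0
  simp only [map_mul, map_pow, mul_eq_zero, pow_eq_zero_iff (show n - 1 ≠ 0 by omega)] at hzero
  rcases hp.eval_eq_zero_or (coneTrinomial_isHomogeneous hm 2) with h2 | h2
  · exact isProjConst_of_trinomial hm hp (A := 2) (B := 3) (by decide)
      (fun w => by rw [← eval_coneTrinomial, h2])
      fun w => hhur 2 3 w (fun _ => rfl) fun k z hz => (hne k z hz).2
  rcases hp.eval_eq_zero_or (coneTrinomial_isHomogeneous hm 3) with h3 | h3
  · exact isProjConst_of_trinomial hm hp (A := 3) (B := 2) (by decide)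
      (fun w => by rw [← eval_coneTrinomial, h3])
      fun w => hhur 3 2 w (fun _ => add_comm _ _) fun k z hz => (hne k z hz).1
  obtain ⟨z, hz2, hz3⟩ := ((h2 0).and (h3 0)).exists
  exact ((hzero z).elim hz2 hz3).elim

end Deformation

end EntireCurve

open EntireCurve in
/-- For all `m ≥ 4`, `n ≥ 2` there are general cones over plane
curves of degrees `m` and `n` in `ℙ⁴` whose intersection projects from
`P₀ = (1:0:0:0:0)` to the surface `Z = {r = 0} ⊂ ℙ³` of degree `mn` (with
`r = res_{z₀}(f,g)`), such that a general small deformation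
`{r + t f_∞ = 0}` of `Z` is Brody hyperbolic. -/
theorem deformation_of_resultant_surface_is_hyperbolic
    (m n : ℕ) (hm : 4 ≤ m) (hn : 2 ≤ n) :
    ∃ f g : MvPolynomial (Fin 3) ℂ,
      f.IsHomogeneous m ∧ g.IsHomogeneous n ∧
      eval ![1, 0, 0] f ≠ 0 ∧ eval ![1, 0, 0] g ≠ 0 ∧
      ∃ r : MvPolynomial (Fin 4) ℂ, r ≠ 0 ∧ r.IsHomogeneous (m * n) ∧
        (∀ z : Fin 4 → ℂ,
          (eval z r = 0 ↔
            ∃ z₀ : ℂ, eval ![z₀, z 0, z 1] f = 0 ∧ eval ![z₀, z 2, z 3] g = 0)) ∧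
        ∃ finf : MvPolynomial (Fin 4) ℂ, finf.IsHomogeneous (m * n) ∧
          ∃ ε > (0 : ℝ), ∀ t : ℂ, 0 < ‖t‖ → ‖t‖ < ε →
            ∀ h : ℂ → (Fin 4 → ℂ), Differentiable ℂ h → (∀ w, h w ≠ 0) →
              (∀ w, eval (h w) r + t * eval (h w) finf = 0) →
              ∀ w w' : ℂ, ¬ LinearIndependent ℂ ![h w, h w'] := by
  have hm0 : m ≠ 0 := by omega
  have hn1 : n - 1 ≠ 0 := by omega
  have hg : ((X 0 - X 1) * (X 0 - X 2) ^ (n - 1) : MvPolynomial (Fin 3) ℂ).IsHomogeneous n := by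
    have hX (i : Fin 3) := (isHomogeneous_X ℂ (0 : Fin 3)).sub (isHomogeneous_X ℂ i)
    have h := (hX 1).mul ((hX 2).pow (n - 1))
    rw [one_mul, Nat.add_sub_cancel' (by omega)] at h
    exact h
  refine ⟨trinomial m, (X 0 - X 1) * (X 0 - X 2) ^ (n - 1), trinomial_isHomogeneous hm, hg,
    by simp [eval_trinomial, hm0, show m - 1 ≠ 0 by omega], by simp,
    coneTrinomial m 2 * coneTrinomial m 3 ^ (n - 1), fun h0 => ?_,
    isHomogeneous_coneTrinomial_mul hm hn, fun z => ?_,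
    (X 2 + X 3) ^ (m * n), isHomogeneous_X_add_X_pow 2 3 _, ?_⟩
  · have := congrArg (eval ![0, 0, 1, 1]) h0
    simp [eval_coneTrinomial, eval_trinomial, hm0, show m - 1 ≠ 0 by omega] at this
  · have he : ∀ j, z ∘ ![j, 0, 1] = ![z j, z 0, z 1] := fun j => by
      ext i
      fin_cases i <;> rfl
    simp only [map_mul, map_pow, mul_eq_zero, pow_eq_zero_iff hn1, eval_coneTrinomial, he, map_sub,
      eval_X]
    constructor
    · rintro (h | h)
      · exact ⟨z 2, h, Or.inl (sub_self _)⟩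
      · exact ⟨z 3, h, Or.inr (sub_self _)⟩
    · rintro ⟨z₀, h, h' | h'⟩
      · exact Or.inl ((show z₀ = z 2 from sub_eq_zero.1 h') ▸ h)
      · exact Or.inr ((show z₀ = z 3 from sub_eq_zero.1 h') ▸ h)
  · by_contra! hcon
    choose t ht0 htε h hd hh0 hzero w w' hind using fun k : ℕ => hcon (1 / ((k : ℝ) + 1))
      (by positivity)
    obtain ⟨l, g, p, hl, hl', hg, hgh, hlim, -, hpn, -⟩ := exists_brody_limit
      (fun k => isProjCurve_of_differentiable (hd k) (hh0 k)) fun k hc => by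
        obtain ⟨c, hc⟩ := hc (w k) (w' k)
        have := LinearIndependent.pair_iff.1 (hind k) c (-1) (by rw [hc]; simp)
        simp at this
    refine hpn (isProjConst_of_coneTrinomial_limit hm hn hlim hg (t := t) ?_
      (fun k => norm_pos_iff.1 (ht0 k)) fun k z => ?_)
    · refine Tendsto.mono_left ?_ hl'
      exact squeeze_zero_norm (fun k => (htε k).le) tendsto_one_div_add_atTop_nhds_zero_nat
    · obtain ⟨v, hv⟩ := hgh k z
      rw [hv, hzero]
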